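/- Let R be a Cohen-Macaulay commutative noetherian ring with a dualizing module D, and let p, q ∈ Spec(R). Then Tor_k^R(Hom_R(D, E_R(R/p)), E_R(R/q)) = 0 if p ≠ q or if k ≠ ht(p), and Tor_k^R(Hom_R(D, E_R(R/p)), E_R(R/q)) ≅ E_R(R/p) if p = q and k = ht(p). -/

import Mathlib

/-!
Common definitions: property t(p), injective hulls, (C-)Gorenstein injective modules,
(C-)Gorenstein injective / injective / flat dimensions, small support, torsion functor,
Tor and Ext modules, semidualizing and dualizing modules, depth, Cohen-Macaulay rings,
Serre's condition (S₁), Gorenstein local rings, minimal injective resolutions.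
-/

universe u

open CategoryTheory Limits DirectSum

noncomputable section

/-- An `R`-module `S` has property `t(p)`: multiplication by every `r ∉ p` is bijective on `S`,
and every element of `S` is annihilated by a power of `p`. -/
def PropT (R : Type u) [CommRing R] (p : Ideal R) (S : Type u) [AddCommGroup S]
    [Module R S] : Prop :=
  (∀ r : R, r ∉ p → Function.Bijective (fun s : S => r • s)) ∧
  (∀ x : S, ∃ m : ℕ, 0 < m ∧ ∀ a ∈ p ^ m, a • x = 0)

/-- `E` is an injective hull of `N` over `R`: `E` is injective and `N` embeds in `E` as an
essential submodule. -/
def IsInjectiveHull (R : Type u) [CommRing R] (N : Type u) [AddCommGroup N] [Module R N]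
    (E : Type u) [AddCommGroup E] [Module R E] : Prop :=
  Module.Injective R E ∧ ∃ ι : N →ₗ[R] E, Function.Injective ι ∧
    ∀ K : Submodule R E, K ≠ ⊥ → K ⊓ LinearMap.range ι ≠ ⊥

/-- A complete injective resolution: a doubly infinite exact sequence of injective modules
which stays exact after applying `Hom_R(-, I)` for every injective module `I`. -/
structure CompleteInjRes (R : Type u) [CommRing R] where
  E : ℤ → Type u
  [acg : ∀ i, AddCommGroup (E i)]
  [mod : ∀ i, Module R (E i)]
  d : ∀ i, E i →ₗ[R] E (i + 1)
  inj : ∀ i, Module.Injective R (E i)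
  exct : ∀ i, LinearMap.range (d i) = LinearMap.ker (d (i + 1))
  homExact : ∀ (I : Type u) [AddCommGroup I] [Module R I], Module.Injective R I →
    ∀ (i : ℤ) (g : E (i + 1) →ₗ[R] I), g ∘ₗ d i = 0 →
      ∃ h : E (i + 1 + 1) →ₗ[R] I, h ∘ₗ d (i + 1) = g

attribute [instance] CompleteInjRes.acg CompleteInjRes.mod

/-- `G` is a Gorenstein injective `R`-module: it is the image of some map in a complete
injective resolution. -/
def GorensteinInjective (R : Type u) [CommRing R] (G : Type u) [AddCommGroup G]
    [Module R G] : Prop :=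
  ∃ X : CompleteInjRes R, Nonempty (G ≃ₗ[R] LinearMap.range (X.d 0))

/-- A complete `I_C I`-resolution: an exact sequence
`⋯ → Hom(C,I₁) → Hom(C,I₀) → I⁰ → I¹ → ⋯` (terms in nonnegative degrees are injective,
terms in negative degrees are of the form `Hom_R(C, I)` with `I` injective) such that
`Hom_R(Hom_R(C,J), -)` leaves it exact for every injective `R`-module `J`. -/
structure CompleteICIRes (R : Type u) [CommRing R] (C : Type u) [AddCommGroup C]
    [Module R C] where
  X : ℤ → Type u
  [acg : ∀ i, AddCommGroup (X i)]
  [mod : ∀ i, Module R (X i)]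
  d : ∀ i, X i →ₗ[R] X (i + 1)
  exct : ∀ i, LinearMap.range (d i) = LinearMap.ker (d (i + 1))
  injPos : ∀ i : ℤ, 0 ≤ i → Module.Injective R (X i)
  homCInjNeg : ∀ i : ℤ, i < 0 → ∃ (I : Type u) (_ : AddCommGroup I) (_ : Module R I),
    Module.Injective R I ∧ Nonempty (X i ≃ₗ[R] (C →ₗ[R] I))
  homExact : ∀ (J : Type u) [AddCommGroup J] [Module R J], Module.Injective R J →
    ∀ (i : ℤ) (g : (C →ₗ[R] J) →ₗ[R] X (i + 1)), d (i + 1) ∘ₗ g = 0 →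
      ∃ h : (C →ₗ[R] J) →ₗ[R] X i, d i ∘ₗ h = g

attribute [instance] CompleteICIRes.acg CompleteICIRes.mod

/-- `G` is a `C`-Gorenstein injective `R`-module: it is the image of the map
`Hom_R(C, I₀) → I⁰` in some complete `I_C I`-resolution. -/
def CGorensteinInjective (R : Type u) [CommRing R] (C : Type u) [AddCommGroup C] [Module R C]
    (G : Type u) [AddCommGroup G] [Module R G] : Prop :=
  ∃ X : CompleteICIRes R C, Nonempty (G ≃ₗ[R] LinearMap.range (X.d (-1)))

/-- `M` has a `C`-Gorenstein injective coresolution `0 → M → G⁰ → ⋯ → Gⁿ → 0`,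
i.e. `C`-Gorenstein injective dimension at most `n`. -/
def CGidLE (R : Type u) [CommRing R] (C : Type u) [AddCommGroup C] [Module R C] :
    ℕ → ModuleCat.{u} R → Prop
  | 0, M => CGorensteinInjective R C M
  | n + 1, M => ∃ (G : ModuleCat.{u} R), CGorensteinInjective R C G ∧
      ∃ ι : M →ₗ[R] G, Function.Injective ι ∧
        CGidLE R C n (ModuleCat.of R (G ⧸ LinearMap.range ι))

/-- The `C`-Gorenstein injective dimension of `M` (equal to `⊤` if `M` admits no bounded
coresolution by `C`-Gorenstein injective modules). -/
def CGid (R : Type u) [CommRing R] (C : Type u) [AddCommGroup C] [Module R C]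
    (M : Type u) [AddCommGroup M] [Module R M] : ℕ∞ :=
  sInf {n : ℕ∞ | ∃ m : ℕ, (m : ℕ∞) = n ∧ CGidLE R C m (ModuleCat.of R M)}

/-- There exists an exact sequence `0 → N → Gₙ → ⋯ → G₁ → M → 0` in which each `Gᵢ` is
`C`-Gorenstein injective (and `N` is arbitrary). -/
def CGICoresApprox (R : Type u) [CommRing R] (C : Type u) [AddCommGroup C] [Module R C] :
    ℕ → ModuleCat.{u} R → Prop
  | 0, _ => True
  | n + 1, M => ∃ (G : ModuleCat.{u} R), CGorensteinInjective R C G ∧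
      ∃ π : G →ₗ[R] M, Function.Surjective π ∧
        CGICoresApprox R C n (ModuleCat.of R (LinearMap.ker π))

/-- The `a`-torsion submodule `Γ_a(N)` of `N`. -/
def torsionSubmodule (R : Type u) [CommRing R] (a : Ideal R) (N : Type u) [AddCommGroup N]
    [Module R N] : Submodule R N :=
  ⨆ m : ℕ, Submodule.torsionBySet R N ((a ^ m : Ideal R) : Set R)

/-- `Tor_i^R(M, N)`, as an object of `ModuleCat R`. -/
abbrev TorM (R : Type u) [CommRing R] (i : ℕ) (M N : Type u) [AddCommGroup M] [Module R M]
    [AddCommGroup N] [Module R N] : ModuleCat.{u} R :=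
  ((Tor (ModuleCat.{u} R) i).obj (ModuleCat.of R M)).obj (ModuleCat.of R N)

/-- `Ext_R^i(M, N)`, as an object of `ModuleCat R`. -/
abbrev ExtM (R : Type u) [CommRing R] (i : ℕ) (M N : Type u) [AddCommGroup M] [Module R M]
    [AddCommGroup N] [Module R N] : ModuleCat.{u} R :=
  ((Ext R (ModuleCat.{u} R) i).obj (Opposite.op (ModuleCat.of R M))).obj (ModuleCat.of R N)

/-- The small support of `M`: primes `p` such that `Tor_i^R(κ(p), M) ≠ 0` for some `i`,
where `κ(p)` is the residue field of `R_p`. -/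
def smallSupport (R : Type u) [CommRing R] (M : Type u) [AddCommGroup M] [Module R M] :
    Set (PrimeSpectrum R) :=
  {p | ∃ i : ℕ,
    Nontrivial (TorM R i (IsLocalRing.ResidueField (Localization.AtPrime p.asIdeal)) M)}

/-- `C` is a semidualizing `R`-module: finitely generated, the homothety map
`R → Hom_R(C,C)` is bijective, and `Ext_R^i(C,C) = 0` for `i ≥ 1`. -/
def IsSemidualizing (R : Type u) [CommRing R] (C : Type u) [AddCommGroup C] [Module R C] : Prop :=
  Module.Finite R C ∧
  Function.Bijective (fun r : R => (r • LinearMap.id : C →ₗ[R] C)) ∧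
  ∀ i : ℕ, 1 ≤ i → Subsingleton (ExtM R i C C)

/-- `M` has injective dimension at most `n`. -/
def InjDimLE (R : Type u) [CommRing R] : ℕ → ModuleCat.{u} R → Prop
  | 0, M => Module.Injective R M
  | n + 1, M => ∃ (I : ModuleCat.{u} R), Module.Injective R I ∧
      ∃ ι : M →ₗ[R] I, Function.Injective ι ∧
        InjDimLE R n (ModuleCat.of R (I ⧸ LinearMap.range ι))

/-- `M` has flat dimension at most `n`. -/
def FlatDimLE (R : Type u) [CommRing R] : ℕ → ModuleCat.{u} R → Prop
  | 0, M => Module.Flat R M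
  | n + 1, M => ∃ (F : ModuleCat.{u} R), Module.Flat R F ∧
      ∃ π : F →ₗ[R] M, Function.Surjective π ∧
        FlatDimLE R n (ModuleCat.of R (LinearMap.ker π))

/-- `D` is a dualizing `R`-module: semidualizing of finite injective dimension. -/
def IsDualizing (R : Type u) [CommRing R] (D : Type u) [AddCommGroup D] [Module R D] : Prop :=
  IsSemidualizing R D ∧ ∃ n : ℕ, InjDimLE R n (ModuleCat.of R D)

/-- The depth of a local ring: the supremum of lengths of regular sequences contained in
the maximal ideal. -/
def localRingDepth (A : Type u) [CommRing A] [IsLocalRing A] : ℕ∞ :=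
  sSup {n : ℕ∞ | ∃ rs : List A, (∀ r ∈ rs, r ∈ IsLocalRing.maximalIdeal A) ∧
    RingTheory.Sequence.IsRegular A rs ∧ (rs.length : ℕ∞) = n}

/-- `R` is a Cohen-Macaulay ring: for each prime `p`, `depth (R_p) = dim (R_p)`. -/
def IsCohenMacaulayRing (R : Type u) [CommRing R] : Prop :=
  ∀ (p : Ideal R) (_ : p.IsPrime),
    (localRingDepth (Localization.AtPrime p) : WithBot ℕ∞) =
      ringKrullDim (Localization.AtPrime p)

/-- Serre's condition `(S₁)`: `depth (R_p) ≥ min (ht p, 1)` for every prime `p`. -/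
def SerreS1 (R : Type u) [CommRing R] : Prop :=
  ∀ (p : Ideal R) (hp : p.IsPrime),
    min (Order.height (⟨p, hp⟩ : PrimeSpectrum R)) 1 ≤ localRingDepth (Localization.AtPrime p)

/-- A Gorenstein local ring: a noetherian local ring of finite self-injective dimension. -/
def IsGorensteinLocalRing (A : Type u) [CommRing A] : Prop :=
  IsLocalRing A ∧ IsNoetherianRing A ∧ ∃ n : ℕ, InjDimLE A n (ModuleCat.of A A)

/-- A minimal injective resolution `0 → D → J⁰ → J¹ → ⋯` of `D`: an exact sequence with all
`Jⁱ` injective, in which the kernel of each differential is an essential submodule. -/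
structure MinimalInjRes (R : Type u) [CommRing R] (D : Type u) [AddCommGroup D]
    [Module R D] where
  J : ℕ → Type u
  [acg : ∀ i, AddCommGroup (J i)]
  [mod : ∀ i, Module R (J i)]
  ε : D →ₗ[R] J 0
  d : ∀ i, J i →ₗ[R] J (i + 1)
  inj : ∀ i, Module.Injective R (J i)
  ε_inj : Function.Injective ε
  exct0 : LinearMap.range ε = LinearMap.ker (d 0)
  exct : ∀ i, LinearMap.range (d i) = LinearMap.ker (d (i + 1))
  minimal : ∀ i, ∀ K : Submodule R (J i), K ≠ ⊥ → K ⊓ LinearMap.ker (d i) ≠ ⊥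

attribute [instance] MinimalInjRes.acg MinimalInjRes.mod

end

section TorLongExactSequence

open MonoidalCategory

variable {R : Type u} [CommRing R]

/-- The complex `M ⊗ P`, functorially in `M`, where `P` is a chain complex. -/
noncomputable abbrev tensorComplex (P : ChainComplex (ModuleCat.{u} R) ℕ) (M : ModuleCat.{u} R) :
    ChainComplex (ModuleCat.{u} R) ℕ :=
  (((tensoringLeft (ModuleCat.{u} R)).obj M).mapHomologicalComplex _).obj P

/-- The map of complexes `M ⊗ P ⟶ M' ⊗ P` induced by `M ⟶ M'`. -/
noncomputable abbrev tensorComplexMap (P : ChainComplex (ModuleCat.{u} R) ℕ)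
    {M M' : ModuleCat.{u} R} (f : M ⟶ M') : tensorComplex P M ⟶ tensorComplex P M' :=
  (NatTrans.mapHomologicalComplex ((tensoringLeft (ModuleCat.{u} R)).map f) _).app P

theorem tensorComplexMap_f_apply (P : ChainComplex (ModuleCat.{u} R) ℕ)
    {M M' : ModuleCat.{u} R} (f : M ⟶ M') (i : ℕ) (z : TensorProduct R M (P.X i)) :
    ((tensorComplexMap P f).f i).hom z = f.hom.rTensor (P.X i) z := rfl

theorem homology_ext_of_cycles {K L : ChainComplex (ModuleCat.{u} R) ℕ} (φ : K ⟶ L) (r : R)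
    (g : K ⟶ L) (i : ℕ) (h : ∀ z : K.X i, (φ.f i).hom z = r • (g.f i).hom z) :
    ∀ x, (HomologicalComplex.homologyMap φ i).hom x =
      r • (HomologicalComplex.homologyMap g i).hom x := by
  intro x
  obtain ⟨c, rfl⟩ := (ModuleCat.epi_iff_surjective (K.homologyπ i)).1 inferInstance x
  have e (ψ : K ⟶ L) : (HomologicalComplex.homologyMap ψ i).hom ((K.homologyπ i).hom c) =
      (L.homologyπ i).hom ((HomologicalComplex.cyclesMap ψ i).hom c) := by
    have := HomologicalComplex.homologyπ_naturality ψ i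
    exact congrArg (fun t => t.hom c) this
  have e' (ψ : K ⟶ L) : (L.iCycles i).hom ((HomologicalComplex.cyclesMap ψ i).hom c) =
      (ψ.f i).hom ((K.iCycles i).hom c) := by
    have := HomologicalComplex.cyclesMap_i ψ i
    exact congrArg (fun t => t.hom c) this
  rw [e, e, ← map_smul]
  congr 1
  apply (ModuleCat.mono_iff_injective (L.iCycles i)).1 inferInstance
  rw [e', map_smul, e', h]

/-- The map induced on `Tor` by a linear map in the first variable. -/
noncomputable def torMap (k : ℕ) {M M' : Type u} [AddCommGroup M] [Module R M] [AddCommGroup M']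
    [Module R M'] (f : M →ₗ[R] M') (N : Type u) [AddCommGroup N] [Module R N] :
    TorM R k M N →ₗ[R] TorM R k M' N :=
  (((Tor (ModuleCat.{u} R) k).map (ModuleCat.ofHom f)).app (ModuleCat.of R N)).hom

variable {M M' M'' : Type u} [AddCommGroup M] [Module R M] [AddCommGroup M']
    [Module R M'] [AddCommGroup M''] [Module R M''] (N : Type u) [AddCommGroup N] [Module R N]

theorem torMap_id (k : ℕ) : torMap k (LinearMap.id : M →ₗ[R] M) N = LinearMap.id := by
  unfold torMap
  have : ModuleCat.ofHom (LinearMap.id : M →ₗ[R] M) = 𝟙 _ := rfl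
  rw [this, CategoryTheory.Functor.map_id]
  rfl

theorem torMap_comp (k : ℕ) (g : M' →ₗ[R] M'') (f : M →ₗ[R] M') :
    torMap k (g ∘ₗ f) N = torMap k g N ∘ₗ torMap k f N := by
  unfold torMap
  rw [ModuleCat.ofHom_comp, Functor.map_comp]
  rfl

/-- `Tor` of linearly equivalent modules. -/
noncomputable def torCongr (k : ℕ) (e : M ≃ₗ[R] M') : TorM R k M N ≃ₗ[R] TorM R k M' N :=
  LinearEquiv.ofLinearMap (torMap k e.toLinearMap N) (torMap k e.symm.toLinearMap N)
    (by rw [← torMap_comp]; simp [torMap_id]) (by rw [← torMap_comp]; simp [torMap_id])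

/-- `Tor` computed by a projective resolution of the second variable. -/
noncomputable def torEquivHomology {N : ModuleCat.{u} R} (P : ProjectiveResolution N) (k : ℕ) (M : Type u)
    [AddCommGroup M] [Module R M] :
    TorM R k M N ≃ₗ[R] (tensorComplex P.complex (ModuleCat.of R M)).homology k :=
  (P.isoLeftDerivedObj ((tensoringLeft (ModuleCat.{u} R)).obj (ModuleCat.of R M)) k).toLinearEquiv

theorem torEquivHomology_torMap {N : ModuleCat.{u} R} (P : ProjectiveResolution N) (k : ℕ)
    (f : M →ₗ[R] M') (x : TorM R k M N) :
    torEquivHomology P k M' (torMap k f N x) =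
      (HomologicalComplex.homologyMap (tensorComplexMap P.complex (ModuleCat.ofHom f)) k).hom
        (torEquivHomology P k M x) := by
  have h := P.leftDerived_app_eq ((tensoringLeft (ModuleCat.{u} R)).map (ModuleCat.ofHom f)) k
  rw [← Category.assoc, Iso.eq_comp_inv] at h
  exact congrArg (fun t => t.hom x) h

theorem torMap_smul_id (k : ℕ) (r : R) (x : TorM R k M N) :
    torMap k (r • LinearMap.id : M →ₗ[R] M) N x = r • x := by
  let P := projectiveResolution (ModuleCat.of R N)
  apply (torEquivHomology P k M).injective
  rw [torEquivHomology_torMap, map_smul]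
  refine (homology_ext_of_cycles _ r (𝟙 _) k (fun z => ?_) _).trans ?_
  · exact (tensorComplexMap_f_apply _ _ k z).trans
      (by rw [ModuleCat.hom_ofHom, LinearMap.rTensor_smul, LinearMap.rTensor_id]; rfl)
  · rw [HomologicalComplex.homologyMap_id]; rfl

theorem tor_exists_pow_smul_eq_zero (k : ℕ) (r : R) (h : ∀ x : M, ∃ n : ℕ, r ^ n • x = 0)
    (x : TorM R k M N) : ∃ n : ℕ, r ^ n • x = 0 := by
  let P := projectiveResolution (ModuleCat.of R N)
  let K := tensorComplex P.complex (ModuleCat.of R M)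
  have key : ∀ z : TensorProduct R M (P.complex.X k), ∃ n : ℕ, r ^ n • z = 0 := by
    intro z
    induction z with
    | zero => exact ⟨0, by simp⟩
    | tmul x y =>
      obtain ⟨n, hn⟩ := h x
      exact ⟨n, by rw [TensorProduct.smul_tmul', hn, TensorProduct.zero_tmul]⟩
    | add x y hx hy =>
      obtain ⟨n, hn⟩ := hx
      obtain ⟨m, hm⟩ := hy
      exact ⟨n + m, by rw [smul_add, pow_add, mul_smul, mul_smul, hm, smul_comm, hn]; simp⟩
  obtain ⟨c, hc⟩ := (ModuleCat.epi_iff_surjective (K.homologyπ k)).1 inferInstance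
    (torEquivHomology P k M x)
  obtain ⟨n, hn⟩ := key ((K.iCycles k).hom c)
  refine ⟨n, (torEquivHomology P k M).injective ?_⟩
  have : r ^ n • c = 0 := by
    apply (ModuleCat.mono_iff_injective (K.iCycles k)).1 inferInstance
    rw [map_zero]
    exact ((K.iCycles k).hom.map_smul _ _).trans hn
  rw [map_smul, ← hc, map_zero]
  exact ((K.homologyπ k).hom.map_smul _ _).symm.trans (by rw [this, map_zero])

end TorLongExactSequence

section TorSequence

open MonoidalCategory

variable {R : Type u} [CommRing R]
variable {M M' M'' : Type u} [AddCommGroup M] [Module R M] [AddCommGroup M']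
    [Module R M'] [AddCommGroup M''] [Module R M''] (N : Type u) [AddCommGroup N] [Module R N]

theorem flat_projectiveResolution {N : ModuleCat.{u} R} (P : ProjectiveResolution N) (i : ℕ) :
    Module.Flat R (P.complex.X i) := by
  have h := P.projective i
  have : Module.Projective R (P.complex.X i) := (IsProjective.iff_projective _).2 h
  infer_instance

/-- The short exact sequence of complexes obtained by tensoring a short exact sequence of modules
with a complex of flat modules. -/
noncomputable def tensorShortComplex (P : ChainComplex (ModuleCat.{u} R) ℕ)
    (f : M →ₗ[R] M') (g : M' →ₗ[R] M'') (h : Function.Exact f g) :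
    ShortComplex (ChainComplex (ModuleCat.{u} R) ℕ) :=
  ShortComplex.mk (tensorComplexMap P (ModuleCat.ofHom f)) (tensorComplexMap P (ModuleCat.ofHom g))
    (by
      ext i : 1
      have : g.rTensor (P.X i) ∘ₗ f.rTensor (P.X i) = 0 := by
        rw [← LinearMap.rTensor_comp, h.linearMap_comp_eq_zero, LinearMap.rTensor_zero]
      exact congrArg ModuleCat.ofHom this)

theorem tensorShortComplex_shortExact (P : ChainComplex (ModuleCat.{u} R) ℕ)
    (hP : ∀ i, Module.Flat R (P.X i))
    {f : M →ₗ[R] M'} {g : M' →ₗ[R] M''} (hf : Function.Injective f) (h : Function.Exact f g)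
    (hg : Function.Surjective g) :
    (tensorShortComplex P f g h).ShortExact := by
  apply HomologicalComplex.shortExact_of_degreewise_shortExact
  intro i
  have := hP i
  apply ModuleCat.shortComplex_shortExact
  · exact rTensor_exact _ h hg
  · exact Module.Flat.rTensor_preserves_injective_linearMap f hf
  · exact LinearMap.rTensor_surjective _ hg

theorem exact_of_shortComplex_exact {S : ShortComplex (ModuleCat.{u} R)} (h : S.Exact) :
    Function.Exact S.f.hom S.g.hom :=
  (ShortComplex.ShortExact.moduleCat_exact_iff_function_exact _).1 h

theorem torMap_exact (k : ℕ) {f : M →ₗ[R] M'} {g : M' →ₗ[R] M''} (hf : Function.Injective f)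
    (h : Function.Exact f g) (hg : Function.Surjective g) :
    Function.Exact (torMap k f N) (torMap k g N) := by
  let P := projectiveResolution (ModuleCat.of R N)
  have hS := tensorShortComplex_shortExact P.complex (flat_projectiveResolution P) hf h hg
  have := exact_of_shortComplex_exact (hS.homology_exact₂ k)
  exact (Function.Exact.iff_of_ladder_linearEquiv (e₁ := torEquivHomology P k M)
    (e₂ := torEquivHomology P k M') (e₃ := torEquivHomology P k M'')
    (LinearMap.ext fun x => (torEquivHomology_torMap P k f x).symm)
    (LinearMap.ext fun x => (torEquivHomology_torMap P k g x).symm)).1 this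

theorem exists_tor_connecting (k : ℕ) {f : M →ₗ[R] M'} {g : M' →ₗ[R] M''}
    (hf : Function.Injective f) (h : Function.Exact f g) (hg : Function.Surjective g) :
    ∃ δ : TorM R (k + 1) M'' N →ₗ[R] TorM R k M N,
      Function.Exact (torMap (k + 1) g N) δ ∧ Function.Exact δ (torMap k f N) := by
  let P := projectiveResolution (ModuleCat.of R N)
  have hS := tensorShortComplex_shortExact P.complex (flat_projectiveResolution P) hf h hg
  have h1 := exact_of_shortComplex_exact (hS.homology_exact₁ (k + 1) k (by simp))
  have h3 := exact_of_shortComplex_exact (hS.homology_exact₃ (k + 1) k (by simp))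
  refine ⟨(torEquivHomology P k M).symm.toLinearMap ∘ₗ (hS.δ (k + 1) k (by simp)).hom ∘ₗ
    (torEquivHomology P (k + 1) M'').toLinearMap, ?_, ?_⟩
  · refine (Function.Exact.iff_of_ladder_linearEquiv (e₁ := torEquivHomology P (k + 1) M')
      (e₂ := torEquivHomology P (k + 1) M'') (e₃ := torEquivHomology P k M)
      (LinearMap.ext fun x => (torEquivHomology_torMap P (k + 1) g x).symm)
      (LinearMap.ext fun x => ?_)).1 h3
    exact ((torEquivHomology P k M).apply_symm_apply _).symm
  · refine (Function.Exact.iff_of_ladder_linearEquiv (e₁ := torEquivHomology P (k + 1) M'')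
      (e₂ := torEquivHomology P k M) (e₃ := torEquivHomology P k M')
      (LinearMap.ext fun x => ?_)
      (LinearMap.ext fun x => (torEquivHomology_torMap P k f x).symm)).1 h1
    exact ((torEquivHomology P k M).apply_symm_apply _).symm

theorem torMap_zero_surjective {g : M' →ₗ[R] M''} (hg : Function.Surjective g) :
    Function.Surjective (torMap 0 g N) := by
  let P := projectiveResolution (ModuleCat.of R N)
  let K := tensorComplex P.complex (ModuleCat.of R M')
  let L := tensorComplex P.complex (ModuleCat.of R M'')
  let φ : K ⟶ L := tensorComplexMap P.complex (ModuleCat.ofHom g)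
  have : Epi (φ.f 0) := (ModuleCat.epi_iff_surjective _).2 (LinearMap.rTensor_surjective _ hg)
  have h1 : Epi (HomologicalComplex.homologyMap φ 0 ≫ L.homologyι 0) := by
    rw [HomologicalComplex.homologyι_naturality]
    have h2 : Epi (K.pOpcycles 0 ≫ HomologicalComplex.opcyclesMap φ 0) := by
      rw [HomologicalComplex.p_opcyclesMap]
      infer_instance
    have := epi_of_epi (K.pOpcycles 0) (HomologicalComplex.opcyclesMap φ 0)
    infer_instance
  have h2 : Function.Surjective (HomologicalComplex.homologyMap φ 0).hom := by
    rw [← ModuleCat.epi_iff_surjective]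
    have : HomologicalComplex.homologyMap φ 0 =
      (HomologicalComplex.homologyMap φ 0 ≫ L.homologyι 0) ≫ inv (L.homologyι 0) := by
      rw [Category.assoc, IsIso.hom_inv_id, Category.comp_id]
    rw [this]
    infer_instance
  intro y
  obtain ⟨x, hx⟩ := h2 (torEquivHomology P 0 M'' y)
  refine ⟨(torEquivHomology P 0 M').symm x, (torEquivHomology P 0 M'').injective ?_⟩
  rw [torEquivHomology_torMap, LinearEquiv.apply_symm_apply]
  exact hx

theorem subsingleton_tor_of_flat [Module.Flat R M] (k : ℕ) :
    Subsingleton (TorM R (k + 1) M N) := by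
  let P := projectiveResolution (ModuleCat.of R N)
  apply (torEquivHomology P (k + 1) M).toEquiv.subsingleton_congr.2
  have : (tensorComplex P.complex (ModuleCat.of R M)).ExactAt (k + 1) := by
    rw [HomologicalComplex.exactAt_iff]
    exact (P.complex_exactAt_succ k).map ((tensoringLeft (ModuleCat.{u} R)).obj (ModuleCat.of R M))
  exact ModuleCat.subsingleton_of_isZero this.isZero_homology

/-- `Tor₀` is the tensor product. -/
noncomputable def torZeroEquiv (M N : Type u) [AddCommGroup M] [Module R M] [AddCommGroup N]
    [Module R N] : TorM R 0 M N ≃ₗ[R] TensorProduct R M N :=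
  (((tensoringLeft (ModuleCat.{u} R)).obj (ModuleCat.of R M)).leftDerivedZeroIsoSelf.app
    (ModuleCat.of R N)).toLinearEquiv

/-- `Tor` of linearly equivalent modules in the second variable. -/
noncomputable def torCongrRight {N N' : Type u} [AddCommGroup N] [Module R N] [AddCommGroup N']
    [Module R N'] (k : ℕ) (M : Type u) [AddCommGroup M] [Module R M] (e : N ≃ₗ[R] N') :
    TorM R k M N ≃ₗ[R] TorM R k M N' :=
  (((Tor (ModuleCat.{u} R) k).obj (ModuleCat.of R M)).mapIso e.toModuleIso).toLinearEquiv

theorem tor_map_right_smul_id (k : ℕ) (r : R) (x : TorM R k M N) :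
    (((Tor (ModuleCat.{u} R) k).obj (ModuleCat.of R M)).map
      (ModuleCat.ofHom (r • LinearMap.id : N →ₗ[R] N))).hom x = r • x := by
  let P := projectiveResolution (ModuleCat.of R N)
  let F := (tensoringLeft (ModuleCat.{u} R)).obj (ModuleCat.of R M)
  have h := P.isoLeftDerivedObj_hom_naturality (ModuleCat.ofHom (r • LinearMap.id : N →ₗ[R] N)) P
    (r • 𝟙 _) (by
      ext x
      change P.π.f 0 (r • x) = r • P.π.f 0 x
      exact (P.π.f 0).hom.map_smul r x) F k
  apply (torEquivHomology P k M).injective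
  refine (congrArg (fun t => t.hom x) h).trans ?_
  rw [map_smul]
  refine (homology_ext_of_cycles _ r (𝟙 _) k (fun z => ?_) _).trans ?_
  · have : (((F.mapHomologicalComplex _).map (r • 𝟙 P.complex)).f k) = ModuleCat.ofHom
      ((r • LinearMap.id : P.complex.X k →ₗ[R] P.complex.X k).lTensor M) := rfl
    refine (congrArg (fun t => t.hom z) this).trans ?_
    exact DFunLike.congr_fun (LinearMap.lTensor_smul M r LinearMap.id) z |>.trans
      (by rw [LinearMap.lTensor_id]; rfl)
  · rw [HomologicalComplex.homologyMap_id]; rfl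

theorem tor_smul_bijective_right (k : ℕ) (r : R) (h : Function.Bijective (fun x : N => r • x)) :
    Function.Bijective (fun x : TorM R k M N => r • x) := by
  let e : N ≃ₗ[R] N := LinearEquiv.ofBijective (r • LinearMap.id) h
  have := (torCongrRight k M e).bijective
  convert this using 1
  ext x
  exact (tor_map_right_smul_id N k r x).symm

end TorSequence

section InjectiveHull

variable {R : Type u} [CommRing R]

theorem IsInjectiveHull.exists_generator {p : Ideal R} {E : Type u} [AddCommGroup E] [Module R E]
    (h : IsInjectiveHull R (R ⧸ p) E) :
    ∃ e : E, (∀ r : R, r • e = 0 ↔ r ∈ p) ∧ ∀ x : E, x ≠ 0 → ∃ a b : R, a • x = b • e ∧ b ∉ p := by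
  obtain ⟨-, ι, hι, hess⟩ := h
  have key (r : R) : r • ι 1 = 0 ↔ r ∈ p := by
    rw [← map_smul, map_eq_zero_iff _ hι, ← Ideal.Quotient.eq_zero_iff_mem]
    simp [Algebra.smul_def]
  refine ⟨ι 1, key, fun x hx => ?_⟩
  have := hess (Submodule.span R {x}) (by simpa using hx)
  obtain ⟨y, ⟨hy, ⟨z, hz⟩⟩, hne⟩ := (Submodule.ne_bot_iff _).1 this
  obtain ⟨a, rfl⟩ := Submodule.mem_span_singleton.1 hy
  obtain ⟨b, rfl⟩ := Ideal.Quotient.mk_surjective z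
  have hb : ι (Ideal.Quotient.mk p b) = b • ι 1 := by
    rw [← map_smul]; simp [Algebra.smul_def]
  refine ⟨a, b, hz ▸ hb, fun hbp => hne ?_⟩
  rw [← hz, hb, key]
  exact hbp

theorem IsInjectiveHull.exists_pow_smul_eq_zero [IsNoetherianRing R] {p : Ideal R} {E : Type u}
    [AddCommGroup E] [Module R E] (h : IsInjectiveHull R (R ⧸ p) E) {r : R} (hr : r ∈ p) (x : E) :
    ∃ n : ℕ, r ^ n • x = 0 := by
  obtain ⟨e, he, hess⟩ := h.exists_generator
  let J : ℕ →o Ideal R := ⟨fun n => LinearMap.ker (LinearMap.toSpanSingleton R E (r ^ n • x)),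
    monotone_nat_of_le_succ fun n a ha => by
      simp only [LinearMap.mem_ker, LinearMap.toSpanSingleton_apply] at ha ⊢
      rw [pow_succ', mul_smul, smul_comm, ha, smul_zero]⟩
  obtain ⟨n, hn⟩ := monotone_stabilizes_iff_noetherian.2 ‹IsNoetherianRing R› J
  refine ⟨n, ?_⟩
  by_contra hne
  obtain ⟨a, b, hab, hb⟩ := hess _ hne
  have h1 : r • a • r ^ n • x = 0 := by rw [hab, smul_smul, he]; exact p.mul_mem_right _ hr
  have h2 : a ∈ J (n + 1) := by
    change a • r ^ (n + 1) • x = 0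
    rw [pow_succ', mul_smul, smul_comm, h1]
  rw [← hn (n + 1) (Nat.le_succ n)] at h2
  have h3 : a • r ^ n • x = 0 := h2
  rw [hab, he] at h3
  exact hb h3

theorem IsInjectiveHull.smul_bijective {p : Ideal R} [hp : p.IsPrime] {E : Type u}
    [AddCommGroup E] [Module R E] (h : IsInjectiveHull R (R ⧸ p) E) {r : R} (hr : r ∉ p) :
    Function.Bijective (fun x : E => r • x) := by
  obtain ⟨e, he, hess⟩ := h.exists_generator
  have hinj : Function.Injective (LinearMap.lsmul R E r) := by
    rw [injective_iff_map_eq_zero]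
    intro x hx
    rw [LinearMap.lsmul_apply] at hx
    by_contra hne
    obtain ⟨a, b, hab, hb⟩ := hess _ hne
    have : (r * b) • e = 0 := by rw [mul_smul, ← hab, smul_comm, hx, smul_zero]
    rw [he] at this
    exact (hp.mem_or_mem this).elim hr hb
  refine ⟨hinj, fun x => ?_⟩
  obtain ⟨g, hg⟩ := h.1.out (LinearMap.lsmul R E r) hinj LinearMap.id
  refine ⟨g x, ?_⟩
  have := hg x
  rw [LinearMap.lsmul_apply, map_smul] at this
  exact this

theorem linearMap_exists_pow_smul_eq_zero {D E : Type u} [AddCommGroup D] [Module R D]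
    [AddCommGroup E] [Module R E] [Module.Finite R D] {r : R}
    (h : ∀ x : E, ∃ n : ℕ, r ^ n • x = 0) (f : D →ₗ[R] E) : ∃ n : ℕ, r ^ n • f = 0 := by
  obtain ⟨S, hS⟩ := (Module.Finite.fg_top : (⊤ : Submodule R D).FG)
  choose n hn using fun d => h (f d)
  refine ⟨S.sup n, LinearMap.ext_on hS fun d hd => ?_⟩
  obtain ⟨c, hc⟩ := Nat.exists_eq_add_of_le' (Finset.le_sup (f := n) hd)
  rw [LinearMap.smul_apply, hc, pow_add, mul_smul, hn, smul_zero, LinearMap.zero_apply]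

theorem linearMap_smul_bijective {D E : Type u} [AddCommGroup D] [Module R D]
    [AddCommGroup E] [Module R E] {r : R} (h : Function.Bijective (fun x : E => r • x)) :
    Function.Bijective (fun f : D →ₗ[R] E => r • f) := by
  refine ⟨fun f g hfg => LinearMap.ext fun d => h.1 (LinearMap.congr_fun hfg d), fun f => ?_⟩
  let e : E ≃ₗ[R] E := LinearEquiv.ofBijective (LinearMap.lsmul R E r) h
  refine ⟨e.symm.toLinearMap ∘ₗ f, LinearMap.ext fun d => ?_⟩
  exact e.apply_symm_apply (f d)

theorem subsingleton_of_pow_smul_eq_zero {T : Type u} [AddCommGroup T] [Module R T] {r : R}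
    (hr : Function.Injective (fun x : T => r • x)) (h : ∀ x : T, ∃ n : ℕ, r ^ n • x = 0) :
    Subsingleton T := by
  refine subsingleton_of_forall_eq 0 fun x => ?_
  obtain ⟨n, hn⟩ := h x
  have hr : IsSMulRegular T r := hr
  exact (hr.pow n) (by simpa using hn)

theorem exists_flat_surjective_of_bijective {r : R} {M : Type u} [AddCommGroup M] [Module R M]
    (hM : Function.Bijective (fun x : M => r • x)) :
    ∃ (F : Type u) (_ : AddCommGroup F) (_ : Module R F), Module.Flat R F ∧
      Function.Bijective (fun x : F => r • x) ∧ ∃ g : F →ₗ[R] M, Function.Surjective g := by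
  let S := Submonoid.powers r
  let F := LocalizedModule S (M →₀ R)
  have : Module.Flat R F := by
    have : Module.Flat R (Localization S) := IsLocalization.flat _ S
    exact Module.Flat.trans R (Localization S) F
  have hu : ∀ x : S, IsUnit ((algebraMap R (Module.End R M)) x) := by
    rintro ⟨_, n, rfl⟩
    rw [map_pow]
    exact ((Module.End.isUnit_iff _).2 hM).pow n
  let g : F →ₗ[R] M := LocalizedModule.lift S (Finsupp.linearCombination R id) hu
  have hg : Function.Surjective g := by
    have h := Finsupp.linearCombination_id_surjective R M
    rw [← LocalizedModule.lift_comp S (Finsupp.linearCombination R id) hu] at h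
    rw [LinearMap.coe_comp] at h
    exact Function.Surjective.of_comp h
  have hF : Function.Bijective (fun x : F => r • x) :=
    (Module.End.isUnit_iff _).1 (IsLocalizedModule.map_units
      (LocalizedModule.mkLinearMap S (M →₀ R)) ⟨r, Submonoid.mem_powers r⟩)
  exact ⟨F, inferInstance, inferInstance, this, hF, g, hg⟩

theorem subsingleton_tor_of_bijective_of_torsion (k : ℕ) {r : R} {N : Type u} [AddCommGroup N]
    [Module R N] (hN : ∀ x : N, ∃ n : ℕ, r ^ n • x = 0) (M : Type u) [AddCommGroup M] [Module R M]
    (hM : Function.Bijective (fun x : M => r • x)) : Subsingleton (TorM R k M N) := by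
  induction k generalizing M with
  | zero =>
    apply (torZeroEquiv M N).toEquiv.subsingleton_congr.2
    refine subsingleton_of_forall_eq 0 fun z => ?_
    induction z with
    | zero => rfl
    | tmul m n =>
      obtain ⟨k, hk⟩ := hN n
      have hpow : Function.Surjective (fun x : M => r ^ k • x) := by
        have := hM.2.iterate k
        rwa [smul_iterate] at this
      obtain ⟨m, rfl⟩ := hpow m
      rw [TensorProduct.smul_tmul, hk, TensorProduct.tmul_zero]
    | add x y hx hy => rw [hx, hy, add_zero]
  | succ k ih =>
    obtain ⟨F, _, _, _, hF, g, hg⟩ := exists_flat_surjective_of_bijective hM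
    have hK : Function.Bijective (fun x : LinearMap.ker g => r • x) := by
      refine ⟨fun x y hxy => Subtype.ext (hF.1 (congrArg Subtype.val hxy)), fun x => ?_⟩
      obtain ⟨y, hy⟩ := hF.2 x.1
      have hy : r • y = x.1 := hy
      have hgy : r • g y = r • 0 := by rw [← map_smul, hy, x.2, smul_zero]
      exact ⟨⟨y, hM.1 hgy⟩, Subtype.ext hy⟩
    have := ih (LinearMap.ker g) hK
    have := subsingleton_tor_of_flat (R := R) N k (M := F)
    obtain ⟨δ, h1, h2⟩ := exists_tor_connecting N k (LinearMap.ker g).injective_subtype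
      (LinearMap.exact_subtype_ker_map g) hg
    refine subsingleton_of_forall_eq 0 fun x => ?_
    obtain ⟨y, rfl⟩ := (h1 x).1 (Subsingleton.elim _ _)
    rw [Subsingleton.elim y 0, map_zero]

theorem subsingleton_tor_linearMap_of_ne [IsNoetherianRing R] {p q : Ideal R} [p.IsPrime]
    [q.IsPrime] (hpq : p ≠ q) (D : Type u) [AddCommGroup D] [Module R D] [Module.Finite R D]
    {Ep : Type u} [AddCommGroup Ep] [Module R Ep] (hEp : IsInjectiveHull R (R ⧸ p) Ep)
    {Eq : Type u} [AddCommGroup Eq] [Module R Eq] (hEq : IsInjectiveHull R (R ⧸ q) Eq) (k : ℕ) :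
    Subsingleton (TorM R k (D →ₗ[R] Ep) Eq) := by
  by_cases h : p ≤ q
  · obtain ⟨r, hrq, hrp⟩ := Set.not_subset.1 fun h' => hpq (le_antisymm h h')
    exact subsingleton_tor_of_bijective_of_torsion k (fun x => hEq.exists_pow_smul_eq_zero hrq x) _
      (linearMap_smul_bijective (hEp.smul_bijective hrp))
  · obtain ⟨r, hrp, hrq⟩ := Set.not_subset.1 h
    exact subsingleton_of_pow_smul_eq_zero
      (tor_smul_bijective_right Eq k r (hEq.smul_bijective hrq)).1
      (tor_exists_pow_smul_eq_zero Eq k r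
        (linearMap_exists_pow_smul_eq_zero (hEp.exists_pow_smul_eq_zero hrp)))

end InjectiveHull

section Pointwise

open scoped Pointwise

section TorConcentrated

variable {R : Type u} [CommRing R]

/-- `Tor_k(M, N)` vanishes for `k ≠ d` and is isomorphic to `T` for `k = d`. -/
def TorConcentrated (d : ℕ) (M N T : Type u) [AddCommGroup M] [Module R M] [AddCommGroup N]
    [Module R N] [AddCommGroup T] [Module R T] : Prop :=
  (∀ k, k ≠ d → Subsingleton (TorM R k M N)) ∧ Nonempty (TorM R d M N ≃ₗ[R] T)

theorem TorConcentrated.congr {d : ℕ} {M M' N T T' : Type u} [AddCommGroup M] [Module R M]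
    [AddCommGroup M'] [Module R M'] [AddCommGroup N] [Module R N] [AddCommGroup T] [Module R T]
    [AddCommGroup T'] [Module R T'] (h : TorConcentrated (R := R) d M N T) (e : M' ≃ₗ[R] M)
    (e' : T ≃ₗ[R] T') : TorConcentrated (R := R) d M' N T' :=
  ⟨fun k hk => have := h.1 k hk
    (torCongr N k e).toEquiv.subsingleton,
    h.2.map fun f => (torCongr N d e).trans (f.trans e')⟩

theorem torMap_lsmul (k : ℕ) (r : R) {M N : Type u} [AddCommGroup M] [Module R M]
    [AddCommGroup N] [Module R N] : torMap k (LinearMap.lsmul R M r) N = LinearMap.lsmul R _ r :=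
  LinearMap.ext fun x => torMap_smul_id N k r x

variable {E : Type u} [AddCommGroup E] [Module R E]

theorem lsmul_linearMap_surjective [Module.Injective R E] {M : Type u} [AddCommGroup M]
    [Module R M] {x : R} (hx : IsSMulRegular M x) :
    Function.Surjective (LinearMap.lsmul R (M →ₗ[R] E) x) := by
  intro f
  obtain ⟨g, hg⟩ := Module.Injective.out (Q := E) (LinearMap.lsmul R M x) hx f
  refine ⟨g, LinearMap.ext fun m => ?_⟩
  rw [← hg m, LinearMap.lsmul_apply, LinearMap.lsmul_apply, map_smul, LinearMap.smul_apply]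

theorem exact_lcomp_mkQ_lsmul {M : Type u} [AddCommGroup M] [Module R M] (x : R) :
    Function.Exact (LinearMap.lcomp R E (x • (⊤ : Submodule R M)).mkQ)
      (LinearMap.lsmul R (M →ₗ[R] E) x) := by
  intro f
  constructor
  · intro h
    refine ⟨(x • (⊤ : Submodule R M)).liftQ f ?_, ?_⟩
    · rintro _ ⟨m, -, rfl⟩
      have := LinearMap.congr_fun h m
      rwa [LinearMap.lsmul_apply, LinearMap.smul_apply, ← map_smul] at this
    · ext m; simp
  · rintro ⟨g, rfl⟩
    ext m
    simp only [LinearMap.lsmul_apply, LinearMap.smul_apply, LinearMap.lcomp_apply,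
      LinearMap.zero_apply, ← map_smul]
    rw [Submodule.mkQ_apply,
      (Submodule.Quotient.mk_eq_zero _).2 (Submodule.smul_mem_pointwise_smul m x ⊤ trivial),
      map_zero]

theorem lcomp_mkQ_injective {M : Type u} [AddCommGroup M] [Module R M] (x : R) :
    Function.Injective (LinearMap.lcomp R E (x • (⊤ : Submodule R M)).mkQ) := by
  intro f g h
  ext m
  exact LinearMap.congr_fun h m

theorem exact_lsmul_mkQ {M : Type u} [AddCommGroup M] [Module R M] (x : R) :
    Function.Exact (LinearMap.lsmul R M x) (x • (⊤ : Submodule R M)).mkQ := by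
  rw [LinearMap.exact_iff, Submodule.ker_mkQ]
  ext m
  simp [Submodule.mem_smul_pointwise_iff_exists]

theorem TorConcentrated.quotSMulTop [Module.Injective R E] {j : ℕ} {A N : Type u} [AddCommGroup A]
    [Module R A] [AddCommGroup N] [Module R N] {x : R} (hx : IsSMulRegular A x)
    (h : TorConcentrated (R := R) j A N (A →ₗ[R] E)) :
    TorConcentrated (R := R) (j + 1) (QuotSMulTop x A) N (QuotSMulTop x A →ₗ[R] E) := by
  obtain ⟨h0, ⟨e⟩⟩ := h
  have hex := exact_lsmul_mkQ (M := A) x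
  have hinj : Function.Injective (LinearMap.lsmul R A x) := hx
  have hsurj := (x • (⊤ : Submodule R A)).mkQ_surjective
  have hxs (k : ℕ) : Function.Surjective (torMap k (LinearMap.lsmul R A x) N) := by
    by_cases hk : k = j
    · subst hk
      intro t
      obtain ⟨f, hf⟩ := lsmul_linearMap_surjective hx (e t)
      refine ⟨e.symm f, e.injective ?_⟩
      rw [torMap_lsmul, LinearMap.lsmul_apply, map_smul, e.apply_symm_apply]
      exact hf
    · have := h0 k hk
      exact fun t => ⟨t, Subsingleton.elim _ _⟩
  have hmk (k : ℕ) (t) : torMap k (x • (⊤ : Submodule R A)).mkQ N t = 0 :=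
    (torMap_exact N k hinj hex hsurj t).2 (hxs k t)
  choose δ h1 h2 using fun k => exists_tor_connecting N k hinj hex hsurj
  have hδ (k : ℕ) : Function.Injective (δ k) := by
    rw [injective_iff_map_eq_zero]
    intro t ht
    obtain ⟨s, rfl⟩ := (h1 k t).1 ht
    exact hmk _ s
  refine ⟨fun k hk => ?_, ?_⟩
  · cases k with
    | zero =>
      refine subsingleton_of_forall_eq 0 fun t => ?_
      obtain ⟨s, rfl⟩ := torMap_zero_surjective N hsurj t
      exact hmk _ s
    | succ k =>
      have := h0 k (by lia)
      exact (hδ k).subsingleton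
  · have e1 := LinearEquiv.ofInjective (δ j) (hδ j)
    have e2 := LinearEquiv.ofInjective _ (lcomp_mkQ_injective (R := R) (E := E) (M := A) x)
    have hr : (LinearMap.range (δ j)).map (e : TorM R j A N →ₗ[R] (A →ₗ[R] E)) =
        LinearMap.range (LinearMap.lcomp R E (x • (⊤ : Submodule R A)).mkQ) := by
      rw [← (LinearMap.exact_iff.1 (h2 j)), ← LinearMap.exact_iff.1 (exact_lcomp_mkQ_lsmul x)]
      ext f
      simp only [Submodule.mem_map, LinearMap.mem_ker, torMap_lsmul, LinearMap.lsmul_apply]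
      constructor
      · rintro ⟨t, ht, rfl⟩
        change x • e t = 0
        rw [← map_smul, ht, map_zero]
      · intro hf
        exact ⟨e.symm f, by rw [← map_smul, hf, map_zero], e.apply_symm_apply f⟩
    exact ⟨e1.trans ((e.submoduleMap _).trans ((LinearEquiv.ofEq _ _ hr).trans e2.symm))⟩

theorem TorConcentrated.quotient_ofList [Module.Injective R E] (rs : List R) {j : ℕ} {A N : Type u}
    [AddCommGroup A] [Module R A] [AddCommGroup N] [Module R N]
    (hrs : RingTheory.Sequence.IsWeaklyRegular A rs)
    (h : TorConcentrated (R := R) j A N (A →ₗ[R] E)) :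
    TorConcentrated (R := R) (j + rs.length) (A ⧸ (Ideal.ofList rs • (⊤ : Submodule R A))) N
      ((A ⧸ (Ideal.ofList rs • (⊤ : Submodule R A))) →ₗ[R] E) := by
  induction rs generalizing A j with
  | nil =>
    let e : (A ⧸ (Ideal.ofList ([] : List R) • (⊤ : Submodule R A))) ≃ₗ[R] A :=
      Submodule.quotEquivOfEqBot _ (by rw [Ideal.ofList_nil, Submodule.bot_smul])
    exact h.congr e (LinearEquiv.congrLeft E R e.symm)
  | cons r rs ih =>
    rw [RingTheory.Sequence.isWeaklyRegular_cons_iff] at hrs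
    have := ih hrs.2 (h.quotSMulTop hrs.1)
    let e := Submodule.quotOfListConsSMulTopEquivQuotSMulTopInner A r rs
    rw [List.length_cons, add_comm rs.length, ← add_assoc]
    exact this.congr e (LinearEquiv.congrLeft E R e.symm)

theorem TorConcentrated.of_quotSMulTop [Module.Injective R E] {d : ℕ} {X : Type u}
    [AddCommGroup X] [Module R X] {I : Ideal R} {x : R} (hI : ∀ a ∈ I, ∀ y : X, a • y = 0)
    (hx : IsSMulRegular X x) (hX : ∀ f : X →ₗ[R] E, ∃ n : ℕ, x ^ n • f = 0)
    (hE : ∀ y : E, ∃ n : ℕ, x ^ n • y = 0)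
    (h : TorConcentrated (R := R) d (QuotSMulTop x X →ₗ[R] E) E
      (Submodule.torsionBySet R E (I ⊔ Ideal.span {x} : Ideal R))) :
    TorConcentrated (R := R) d (X →ₗ[R] E) E (Submodule.torsionBySet R E I) := by
  obtain ⟨h0, ⟨e⟩⟩ := h
  have hex := exact_lcomp_mkQ_lsmul (E := E) (M := X) x
  have hinj := lcomp_mkQ_injective (R := R) (E := E) (M := X) x
  have hsurj := lsmul_linearMap_surjective (E := E) hx
  have htors (k : ℕ) := tor_exists_pow_smul_eq_zero E k x hX
  have hvan (k : ℕ) (hk : k ≠ d) : Subsingleton (TorM R k (X →ₗ[R] E) E) := by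
    refine subsingleton_of_pow_smul_eq_zero (r := x) ?_ (htors k)
    have := torMap_exact E k hinj hex hsurj
    rw [torMap_lsmul] at this
    refine (injective_iff_map_eq_zero (LinearMap.lsmul R _ x)).2 fun t ht => ?_
    obtain ⟨s, rfl⟩ := (this t).1 ht
    have := h0 k hk
    rw [Subsingleton.elim s 0, map_zero]
  refine ⟨hvan, ?_⟩
  set ι := torMap d (LinearMap.lcomp R E (x • (⊤ : Submodule R X)).mkQ) E with hιdef
  have hι : Function.Injective ι := by
    rw [injective_iff_map_eq_zero]
    intro s hs
    obtain ⟨δ, -, h2⟩ := exists_tor_connecting E d hinj hex hsurj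
    obtain ⟨w, rfl⟩ := (h2 s).1 hs
    have := hvan (d + 1) (by simp)
    rw [Subsingleton.elim w 0, map_zero]
  have hker (t : TorM R d (X →ₗ[R] E) E) (ht : x • t = 0) : ∃ s, ι s = t := by
    have := torMap_exact E d hinj hex hsurj
    rw [torMap_lsmul] at this
    exact (this t).1 ht
  have hdiv : Function.Surjective (fun t : TorM R d (X →ₗ[R] E) E => x • t) := by
    have key : Function.Surjective (torMap d (LinearMap.lsmul R (X →ₗ[R] E) x) E) := by
      cases d with
      | zero => exact torMap_zero_surjective E hsurj
      | succ d =>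
        obtain ⟨δ, h1, -⟩ := exists_tor_connecting E d hinj hex hsurj
        have := h0 d (by simp)
        exact fun t => (h1 t).1 (Subsingleton.elim _ _)
    rwa [torMap_lsmul] at key
  obtain ⟨g, hg⟩ := Module.Injective.out (Q := E) ι hι (Submodule.subtype _ ∘ₗ e.toLinearMap)
  have hg' (s) : g (ι s) = (e s : E) := hg s
  have hginj : Function.Injective g := by
    rw [← LinearMap.ker_eq_bot, ← Submodule.subsingleton_iff_eq_bot]
    refine subsingleton_of_pow_smul_eq_zero (r := x) ?_ fun t => ?_
    · refine (injective_iff_map_eq_zero (LinearMap.lsmul R (LinearMap.ker g) x)).2 fun t ht => ?_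
      obtain ⟨s, hs⟩ := hker t.1 (congrArg Subtype.val ht)
      have h3 : (e s : E) = 0 := by rw [← hg', hs]; exact t.2
      have h4 : s = 0 := by simpa using h3
      exact Subtype.ext (by rw [← hs, h4, map_zero]; rfl)
    · obtain ⟨n, hn⟩ := htors d t.1
      exact ⟨n, Subtype.ext hn⟩
  have hgI (t) : g t ∈ Submodule.torsionBySet R E I := by
    rw [Submodule.mem_torsionBySet_iff]
    rintro ⟨a, ha⟩
    have h1 : LinearMap.lsmul R (X →ₗ[R] E) a = LinearMap.lsmul R (X →ₗ[R] E) 0 := by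
      ext f y
      simp [← map_smul, hI a ha y]
    have h2 : a • t = 0 := by
      have := LinearMap.congr_fun (torMap_lsmul (M := X →ₗ[R] E) (N := E) d a) t
      rw [h1, torMap_lsmul] at this
      exact this.symm.trans (by rw [LinearMap.lsmul_apply, zero_smul])
    change a • g t = 0
    rw [← map_smul, h2, map_zero]
  have hsur (n : ℕ) : ∀ y ∈ Submodule.torsionBySet R E I, x ^ n • y = 0 → ∃ t, g t = y := by
    induction n with
    | zero => exact fun y _ hy => ⟨0, by simpa using hy.symm⟩
    | succ n ih =>
      intro y hy hn
      obtain ⟨t, ht⟩ := ih (x • y) (Submodule.smul_mem _ _ hy) (by rwa [smul_smul, ← pow_succ])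
      obtain ⟨t', rfl⟩ := hdiv t
      have hz : y - g t' ∈ Submodule.torsionBySet R E (I ⊔ Ideal.span {x} : Ideal R) := by
        rw [Submodule.mem_torsionBySet_iff]
        rintro ⟨a, ha⟩
        obtain ⟨b, hb, c, hc, rfl⟩ := Submodule.mem_sup.1 ha
        obtain ⟨c, rfl⟩ := Ideal.mem_span_singleton'.1 hc
        have h1 : b • (y - g t') = 0 :=
          (Submodule.mem_torsionBySet_iff _ _).1 (Submodule.sub_mem _ hy (hgI t')) ⟨b, hb⟩
        have h2 : x • (y - g t') = 0 := by rw [smul_sub, ← map_smul, ← ht, sub_self]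
        change (b + c * x) • (y - g t') = 0
        rw [add_smul, h1, mul_smul, h2, smul_zero, add_zero]
      refine ⟨t' + ι (e.symm ⟨_, hz⟩), ?_⟩
      rw [map_add, hg', e.apply_symm_apply]
      simp
  refine ⟨LinearEquiv.ofBijective (g.codRestrict _ hgI) ⟨fun a b hab => hginj
    (congrArg Subtype.val hab), fun y => ?_⟩⟩
  obtain ⟨n, hn⟩ := hE y.1
  obtain ⟨t, ht⟩ := hsur n y.1 y.2 hn
  exact ⟨t, Subtype.ext ht⟩

theorem TorConcentrated.of_quotient_ofList [Module.Injective R E] (rs : List R) {d : ℕ}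
    {X : Type u} [AddCommGroup X] [Module R X] {I : Ideal R} (hI : ∀ a ∈ I, ∀ y : X, a • y = 0)
    (hrs : RingTheory.Sequence.IsWeaklyRegular X rs)
    (hX : ∀ x ∈ rs, ∀ f : X →ₗ[R] E, ∃ n : ℕ, x ^ n • f = 0)
    (hE : ∀ x ∈ rs, ∀ y : E, ∃ n : ℕ, x ^ n • y = 0)
    (h : TorConcentrated (R := R) d ((X ⧸ (Ideal.ofList rs • (⊤ : Submodule R X))) →ₗ[R] E) E
      (Submodule.torsionBySet R E (I ⊔ Ideal.ofList rs : Ideal R))) :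
    TorConcentrated (R := R) d (X →ₗ[R] E) E (Submodule.torsionBySet R E I) := by
  induction rs generalizing X I with
  | nil =>
    let e : (X ⧸ (Ideal.ofList ([] : List R) • (⊤ : Submodule R X))) ≃ₗ[R] X :=
      Submodule.quotEquivOfEqBot _ (by rw [Ideal.ofList_nil, Submodule.bot_smul])
    exact h.congr (LinearEquiv.congrLeft E R e.symm) (LinearEquiv.ofEq _ _ (by simp))
  | cons r rs ih =>
    rw [RingTheory.Sequence.isWeaklyRegular_cons_iff] at hrs
    refine TorConcentrated.of_quotSMulTop hI hrs.1 (hX r (by simp)) (hE r (by simp)) ?_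
    refine ih ?_ hrs.2 (fun x hx f => ?_) (fun x hx => hE x (by simp [hx])) ?_
    · intro a ha y
      obtain ⟨b, hb, c, hc, rfl⟩ := Submodule.mem_sup.1 ha
      obtain ⟨c, rfl⟩ := Ideal.mem_span_singleton'.1 hc
      obtain ⟨y, rfl⟩ := Submodule.mkQ_surjective _ y
      rw [← map_smul, add_smul, hI b hb, zero_add, mul_smul, smul_comm]
      exact (Submodule.Quotient.mk_eq_zero _).2 (Submodule.smul_mem_pointwise_smul _ r ⊤ trivial)
    · obtain ⟨n, hn⟩ := hX x (by simp [hx]) (f ∘ₗ Submodule.mkQ _)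
      refine ⟨n, ?_⟩
      ext y
      exact LinearMap.congr_fun hn y
    · let e := Submodule.quotOfListConsSMulTopEquivQuotSMulTopInner X r rs
      refine h.congr (LinearEquiv.congrLeft E R e.symm) (LinearEquiv.ofEq _ _ ?_)
      rw [Ideal.ofList_cons, sup_assoc]

end TorConcentrated

section HomRegular

variable {R : Type u} [CommRing R] {X Y : Type u} [AddCommGroup X] [Module R X]
  [AddCommGroup Y] [Module R Y]

theorem isSMulRegular_of_linearMap [IsNoetherianRing R] [Module.Finite R X]
    (hann : Module.annihilator R X = ⊥) {x : R} (hx : IsSMulRegular (X →ₗ[R] Y) x) :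
    IsSMulRegular Y x := by
  rw [isSMulRegular_iff_right_eq_zero_of_smul] at hx ⊢
  intro y hy
  have hsub : Subsingleton (X →ₗ[R] Submodule.span R {y}) := by
    refine subsingleton_of_forall_eq 0 fun f => ?_
    have : (Submodule.span R {y}).subtype ∘ₗ f = 0 := by
      refine hx _ (LinearMap.ext fun m => ?_)
      obtain ⟨a, ha⟩ := Submodule.mem_span_singleton.1 (f m).2
      simp only [LinearMap.smul_apply, LinearMap.comp_apply, Submodule.subtype_apply, ← ha,
        LinearMap.zero_apply]
      rw [smul_comm, hy, smul_zero]
    ext m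
    exact LinearMap.congr_fun this m
  obtain ⟨r, hr, hreg⟩ := IsSMulRegular.subsingleton_linearMap_iff.1 hsub
  rw [hann, Submodule.mem_bot] at hr
  subst hr
  have := IsSMulRegular.zero_iff_subsingleton.1 hreg
  have := Subsingleton.elim (⟨y, Submodule.mem_span_singleton_self y⟩ : Submodule.span R {y}) 0
  exact congrArg Subtype.val this

theorem exists_lift_quotSMulTop {x : R} (hx : IsSMulRegular Y x)
    (hext : Subsingleton (Abelian.Ext (ModuleCat.of R X) (ModuleCat.of R Y) 1))
    (f : X →ₗ[R] QuotSMulTop x Y) :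
    ∃ g : X →ₗ[R] Y, (x • (⊤ : Submodule R Y)).mkQ ∘ₗ g = f := by
  have hS := hx.smulShortComplex_shortExact (M := ModuleCat.of R Y)
  obtain ⟨c, hc⟩ := Abelian.Ext.covariant_sequence_exact₃ (ModuleCat.of R X) hS
    (Abelian.Ext.mk₀ (ModuleCat.ofHom f)) (zero_add 1) (hext.elim _ _)
  obtain ⟨g, rfl⟩ := Abelian.Ext.homEquiv₀.symm.surjective c
  refine ⟨g.hom, ?_⟩
  have h2 : g ≫ (ModuleCat.smulShortComplex (ModuleCat.of R Y) x).g = ModuleCat.ofHom f := by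
    apply (Abelian.Ext.mk₀_bijective _ _).1
    rw [← hc]
    exact (Abelian.Ext.mk₀_comp_mk₀ _ _).symm
  exact congrArg ModuleCat.Hom.hom h2

/-- Reduction of homomorphisms modulo `x`. -/
noncomputable def quotSMulTopLinearMap (x : R) :
    QuotSMulTop x (X →ₗ[R] Y) →ₗ[R] X →ₗ[R] QuotSMulTop x Y :=
  Submodule.liftQ _ (LinearMap.llcomp R X Y _ (x • (⊤ : Submodule R Y)).mkQ) (by
    rintro _ ⟨g, -, rfl⟩
    ext m
    exact (Submodule.Quotient.mk_eq_zero _).2 (Submodule.smul_mem_pointwise_smul (g m) x ⊤ trivial))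

theorem quotSMulTopLinearMap_injective {x : R} (hx : IsSMulRegular Y x) :
    Function.Injective (quotSMulTopLinearMap (X := X) (Y := Y) x) := by
  rw [injective_iff_map_eq_zero]
  intro q
  obtain ⟨g, rfl⟩ := Submodule.mkQ_surjective _ q
  intro h
  have h1 (m : X) : ∃ y, x • y = g m := by
    have := (Submodule.Quotient.mk_eq_zero (x • (⊤ : Submodule R Y))).1 (LinearMap.congr_fun h m)
    obtain ⟨y, -, hy⟩ := this
    exact ⟨y, hy⟩
  choose g' hg' using h1
  let G : X →ₗ[R] Y :=
    { toFun := g'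
      map_add' := fun a b => hx (by simp only [smul_add, hg', map_add])
      map_smul' := fun r a => hx (by
        simp only [hg', map_smul, RingHom.id_apply]; rw [smul_comm, hg']) }
  refine (Submodule.Quotient.mk_eq_zero _).2 ⟨G, trivial, LinearMap.ext hg'⟩

/-- If `rs` is weakly regular on `Hom(X, Y)` and `Ext^i(X, Y) = 0` for `i ≥ 1`, then `rs` is weakly
regular on `Y`, and `Hom(X, -)` commutes with reduction of `Y` modulo `rs`. -/
theorem isWeaklyRegular_of_linearMap [IsNoetherianRing R] [Module.Finite R X]
    (hann : Module.annihilator R X = ⊥) (rs : List R)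
    (hext : ∀ i : ℕ, 1 ≤ i → Subsingleton (Abelian.Ext (ModuleCat.of R X) (ModuleCat.of R Y) i))
    (hrs : RingTheory.Sequence.IsWeaklyRegular (X →ₗ[R] Y) rs) :
    RingTheory.Sequence.IsWeaklyRegular Y rs ∧
    ∃ e : ((X →ₗ[R] Y) ⧸ (Ideal.ofList rs • (⊤ : Submodule R (X →ₗ[R] Y)))) ≃ₗ[R]
        (X →ₗ[R] (Y ⧸ (Ideal.ofList rs • (⊤ : Submodule R Y)))),
      ∀ g : X →ₗ[R] Y, e (Submodule.Quotient.mk g) = Submodule.mkQ _ ∘ₗ g := by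
  induction rs generalizing Y with
  | nil =>
    refine ⟨RingTheory.Sequence.IsWeaklyRegular.nil R Y, ?_⟩
    let e0 : ((X →ₗ[R] Y) ⧸ (Ideal.ofList ([] : List R) • (⊤ : Submodule R (X →ₗ[R] Y)))) ≃ₗ[R]
      (X →ₗ[R] Y) := Submodule.quotEquivOfEqBot _ (by rw [Ideal.ofList_nil, Submodule.bot_smul])
    let e : (Y ⧸ (Ideal.ofList ([] : List R) • (⊤ : Submodule R Y))) ≃ₗ[R] Y :=
      Submodule.quotEquivOfEqBot _ (by rw [Ideal.ofList_nil, Submodule.bot_smul])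
    exact ⟨e0.trans (e.symm.congrRight), fun g => rfl⟩
  | cons x rs ih =>
    rw [RingTheory.Sequence.isWeaklyRegular_cons_iff] at hrs
    have hx := isSMulRegular_of_linearMap hann hrs.1
    have hS := hx.smulShortComplex_shortExact (M := ModuleCat.of R Y)
    let e0 : QuotSMulTop x (X →ₗ[R] Y) ≃ₗ[R] (X →ₗ[R] QuotSMulTop x Y) :=
      LinearEquiv.ofBijective (quotSMulTopLinearMap x) ⟨quotSMulTopLinearMap_injective hx, fun f => by
        obtain ⟨g, hg⟩ := exists_lift_quotSMulTop hx (hext 1 le_rfl) f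
        exact ⟨Submodule.Quotient.mk g, hg⟩⟩
    obtain ⟨h1, e1, he1⟩ := ih (Y := QuotSMulTop x Y) (fun i hi => by
      refine subsingleton_of_forall_eq 0 fun c => ?_
      have := hext (i + 1) (by lia)
      obtain ⟨b, rfl⟩ := Abelian.Ext.covariant_sequence_exact₃ (ModuleCat.of R X) hS c rfl
        (this.elim _ _)
      rw [show b = 0 from (hext i hi).elim _ _, Abelian.Ext.zero_comp]
      rfl)
      ((e0.isWeaklyRegular_congr rs).1 hrs.2)
    refine ⟨(RingTheory.Sequence.isWeaklyRegular_cons_iff _ _ _).2 ⟨hx, h1⟩, ?_⟩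
    let e2 : (QuotSMulTop x (X →ₗ[R] Y) ⧸
          (Ideal.ofList rs • (⊤ : Submodule R (QuotSMulTop x (X →ₗ[R] Y))))) ≃ₗ[R]
        ((X →ₗ[R] QuotSMulTop x Y) ⧸
          (Ideal.ofList rs • (⊤ : Submodule R (X →ₗ[R] QuotSMulTop x Y)))) :=
      Submodule.Quotient.equiv _ _ e0 (by
        rw [Submodule.map_smul'', Submodule.map_top]
        congr 1
        exact e0.range)
    let e3 := Submodule.quotOfListConsSMulTopEquivQuotSMulTopInner (X →ₗ[R] Y) x rs
    let e4 := Submodule.quotOfListConsSMulTopEquivQuotSMulTopInner Y x rs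
    refine ⟨e3.trans (e2.trans (e1.trans e4.symm.congrRight)), fun g => ?_⟩
    have : e2 (e3 (Submodule.Quotient.mk g)) =
      Submodule.Quotient.mk ((x • (⊤ : Submodule R Y)).mkQ ∘ₗ g) := rfl
    rw [LinearEquiv.trans_apply, LinearEquiv.trans_apply, LinearEquiv.trans_apply, this, he1]
    rfl

/-- If `X` is finitely generated with `R = Hom(X, X)` and `Ext^i(X, X) = 0` for `i ≥ 1`, then a weakly
`R`-regular sequence `rs` is weakly `X`-regular and `Hom(X/rs, X/rs) = R/rs`. -/
theorem exists_equiv_end_quotient [IsNoetherianRing R] [Module.Finite R X]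
    (hbij : Function.Bijective (fun r : R => (r • LinearMap.id : X →ₗ[R] X)))
    (hext : ∀ i : ℕ, 1 ≤ i → Subsingleton (Abelian.Ext (ModuleCat.of R X) (ModuleCat.of R X) i))
    (rs : List R) (hrs : RingTheory.Sequence.IsWeaklyRegular R rs) :
    RingTheory.Sequence.IsWeaklyRegular X rs ∧
    ∃ e : (R ⧸ (Ideal.ofList rs • (⊤ : Submodule R R))) ≃ₗ[R]
        ((X ⧸ (Ideal.ofList rs • (⊤ : Submodule R X))) →ₗ[R]
          (X ⧸ (Ideal.ofList rs • (⊤ : Submodule R X)))),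
      ∀ r : R, e (Submodule.Quotient.mk r) = r • LinearMap.id := by
  have hann : Module.annihilator R X = ⊥ := by
    rw [eq_bot_iff]
    intro r hr
    refine hbij.1 (LinearMap.ext fun m => ?_)
    simpa using Module.mem_annihilator.1 hr m
  let e0 : R ≃ₗ[R] (X →ₗ[R] X) :=
    LinearEquiv.ofBijective (LinearMap.toSpanSingleton R (X →ₗ[R] X) LinearMap.id) hbij
  obtain ⟨h1, e1, he1⟩ := isWeaklyRegular_of_linearMap hann rs hext
    ((e0.isWeaklyRegular_congr rs).1 hrs)
  refine ⟨h1, ?_⟩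
  let e2 : (R ⧸ (Ideal.ofList rs • (⊤ : Submodule R R))) ≃ₗ[R]
      ((X →ₗ[R] X) ⧸ (Ideal.ofList rs • (⊤ : Submodule R (X →ₗ[R] X)))) :=
    Submodule.Quotient.equiv _ _ e0 (by
      rw [Submodule.map_smul'', Submodule.map_top]
      congr 1
      exact e0.range)
  let P := Ideal.ofList rs • (⊤ : Submodule R X)
  have hbij3 : Function.Bijective (LinearMap.lcomp R (X ⧸ P) P.mkQ) := by
    constructor
    · intro f g h
      ext m
      exact LinearMap.congr_fun h m
    · intro f
      have hP : P ≤ LinearMap.ker f := by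
        refine Submodule.smul_le.2 fun a ha m _ => ?_
        rw [LinearMap.mem_ker, map_smul]
        obtain ⟨y, hy⟩ := Submodule.mkQ_surjective P (f m)
        rw [← hy, ← map_smul]
        exact (Submodule.Quotient.mk_eq_zero _).2 (Submodule.smul_mem_smul ha trivial)
      exact ⟨P.liftQ f hP, LinearMap.ext fun m => P.liftQ_apply (h := hP) f m⟩
  let e3 := LinearEquiv.ofBijective _ hbij3
  refine ⟨e2.trans (e1.trans e3.symm), fun r => ?_⟩
  have : e2 (Submodule.Quotient.mk r) = Submodule.Quotient.mk (r • LinearMap.id : X →ₗ[R] X) := rfl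
  rw [LinearEquiv.trans_apply, LinearEquiv.trans_apply, this, he1, LinearEquiv.symm_apply_eq]
  rfl

end HomRegular

section ExtRegular

variable {R : Type u} [CommRing R]

theorem ext_comp_smul_eq_zero {N Y : Type u} [AddCommGroup N] [Module R N] [AddCommGroup Y]
    [Module R Y] {x : R} (hx : ∀ n : N, x • n = 0) {i : ℕ}
    (c : Abelian.Ext (ModuleCat.of R N) (ModuleCat.of R Y) i) :
    c.comp (Abelian.Ext.mk₀ ((ModuleCat.of R Y).smulShortComplex x).f) (add_zero i) = 0 := by
  have h : (x • 𝟙 (ModuleCat.of R N)) = 0 := by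
    ext n
    exact hx n
  have h2 : x • c = 0 := by
    rw [← Abelian.Ext.mk₀_id_comp c, ← Abelian.Ext.smul_comp, ← Abelian.Ext.mk₀_smul, h,
      Abelian.Ext.mk₀_zero, Abelian.Ext.zero_comp]
  have h3 := (Abelian.Ext.comp_smul c (Abelian.Ext.mk₀ (𝟙 (ModuleCat.of R Y))) (add_zero i) x).trans
    ((congrArg (x • ·) (Abelian.Ext.comp_mk₀_id c)).trans h2)
  rwa [← Abelian.Ext.mk₀_smul] at h3

theorem exists_ext_class_quotSMulTop {Y : Type u} [AddCommGroup Y] [Module R Y] {x : R}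
    (hx : IsSMulRegular Y x) :
    ∃ δ : Abelian.Ext (ModuleCat.of R (QuotSMulTop x Y)) (ModuleCat.of R Y) 1,
      ∀ (N : Type u) [AddCommGroup N] [Module R N], (∀ n : N, x • n = 0) → ∀ i : ℕ,
        Function.Surjective (fun b : Abelian.Ext (ModuleCat.of R N)
          (ModuleCat.of R (QuotSMulTop x Y)) i => b.comp δ (rfl : i + 1 = i + 1)) ∧
        (Subsingleton (Abelian.Ext (ModuleCat.of R N) (ModuleCat.of R Y) i) →
          Function.Injective (fun b : Abelian.Ext (ModuleCat.of R N)
            (ModuleCat.of R (QuotSMulTop x Y)) i => b.comp δ (rfl : i + 1 = i + 1))) := by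
  have hS := hx.smulShortComplex_shortExact (M := ModuleCat.of R Y)
  refine ⟨hS.extClass, fun N _ _ hN i => ⟨fun b => ?_, fun hsub => ?_⟩⟩
  · exact Abelian.Ext.covariant_sequence_exact₁ (ModuleCat.of R N) hS b
      (ext_comp_smul_eq_zero hN b) rfl
  · refine (injective_iff_map_eq_zero (hS.extClass.postcomp (ModuleCat.of R N) rfl)).2 fun b hb => ?_
    obtain ⟨d, rfl⟩ := Abelian.Ext.covariant_sequence_exact₃ (ModuleCat.of R N) hS b rfl hb
    rw [show d = 0 from hsub.elim _ _, Abelian.Ext.zero_comp]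

/-- `Ext^i(N, Y) = 0` for `i` less than the length of a weakly `Y`-regular sequence killing `N`. -/
theorem subsingleton_ext_of_isWeaklyRegular {N Y : Type u} [AddCommGroup N] [Module R N]
    [AddCommGroup Y] [Module R Y] (rs : List R) (hrs : RingTheory.Sequence.IsWeaklyRegular Y rs)
    (hN : ∀ x ∈ rs, ∀ n : N, x • n = 0) (i : ℕ) (hi : i < rs.length) :
    Subsingleton (Abelian.Ext (ModuleCat.of R N) (ModuleCat.of R Y) i) := by
  induction rs generalizing Y i with
  | nil => simp at hi
  | cons x rs ih =>
    rw [RingTheory.Sequence.isWeaklyRegular_cons_iff] at hrs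
    have hx : ∀ n : N, x • n = 0 := hN x List.mem_cons_self
    cases i with
    | zero =>
      have : Subsingleton (N →ₗ[R] Y) := hrs.1.linearMap_subsingleton_of_mem_annihilator
        (Module.mem_annihilator.2 hx)
      exact (Abelian.Ext.homEquiv₀.trans ModuleCat.homEquiv).subsingleton
    | succ i =>
      obtain ⟨δ, hδ⟩ := exists_ext_class_quotSMulTop hrs.1
      have := ih (Y := QuotSMulTop x Y) hrs.2 (fun y hy => hN y (List.mem_cons_of_mem _ hy)) i
        (by simpa using hi)
      exact (hδ N hx i).1.subsingleton

/-- The natural isomorphism `Hom(N, Y/rs) = Ext^n(N, Y)`, for `N` killed by a weakly `Y`-regular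
sequence `rs` of length `n`, is composition with a class in `Ext^n(Y/rs, Y)`. -/
theorem exists_ext_class {Y : Type u} [AddCommGroup Y] [Module R Y] (rs : List R)
    (hrs : RingTheory.Sequence.IsWeaklyRegular Y rs) :
    ∃ c : Abelian.Ext (ModuleCat.of R (Y ⧸ (Ideal.ofList rs • (⊤ : Submodule R Y))))
        (ModuleCat.of R Y) rs.length,
      ∀ (N : Type u) [AddCommGroup N] [Module R N], (∀ x ∈ rs, ∀ n : N, x • n = 0) →
        Function.Bijective (fun f : ModuleCat.of R N ⟶
          ModuleCat.of R (Y ⧸ (Ideal.ofList rs • (⊤ : Submodule R Y))) =>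
            (Abelian.Ext.mk₀ f).comp c (zero_add _)) := by
  induction rs generalizing Y with
  | nil =>
    let e : (Y ⧸ (Ideal.ofList ([] : List R) • (⊤ : Submodule R Y))) ≃ₗ[R] Y :=
      Submodule.quotEquivOfEqBot _ (by rw [Ideal.ofList_nil, Submodule.bot_smul])
    refine ⟨Abelian.Ext.mk₀ e.toModuleIso.hom, fun N _ _ _ => ?_⟩
    simp only [Abelian.Ext.mk₀_comp_mk₀]
    exact (Abelian.Ext.mk₀_bijective _ _).comp (Iso.homCongr (Iso.refl _) e.toModuleIso).bijective
  | cons x rs ih =>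
    rw [RingTheory.Sequence.isWeaklyRegular_cons_iff] at hrs
    obtain ⟨δ, hδ⟩ := exists_ext_class_quotSMulTop hrs.1
    obtain ⟨c, hc⟩ := ih (Y := QuotSMulTop x Y) hrs.2
    let e := (Submodule.quotOfListConsSMulTopEquivQuotSMulTopInner Y x rs).toModuleIso
    refine ⟨(Abelian.Ext.mk₀ e.hom).comp (c.comp δ rfl) (zero_add _), fun N _ _ hN => ?_⟩
    have h1 := hc N (fun y hy => hN y (List.mem_cons_of_mem _ hy))
    obtain ⟨h2, h2'⟩ := hδ N (hN x List.mem_cons_self) rs.length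
    have h2'' := h2' (subsingleton_ext_of_isWeaklyRegular (x :: rs)
      ((RingTheory.Sequence.isWeaklyRegular_cons_iff _ _ _).2 hrs) hN _ (by simp))
    have h3 := (Function.Bijective.comp ⟨h2'', h2⟩ h1).comp
      (Iso.homCongr (Iso.refl (ModuleCat.of R N)) e).bijective
    refine (congrArg Function.Bijective (funext fun f => ?_)).mp h3
    simp only [Function.comp_apply, Iso.homCongr_apply, Iso.refl_inv, Category.id_comp,
      Abelian.Ext.mk₀_comp_mk₀_assoc]
    exact Abelian.Ext.comp_assoc _ _ _ _ _ (by lia)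

end ExtRegular

section ExtVanishing

variable {R : Type u} [CommRing R] {M N L : Type u} [AddCommGroup M] [Module R M] [AddCommGroup N]
  [Module R N] [AddCommGroup L] [Module R L] {f : M →ₗ[R] N} {g : N →ₗ[R] L}

theorem shortExact_of_exact (hf : Function.Injective f) (hfg : Function.Exact f g)
    (hg : Function.Surjective g) :
    (ModuleCat.shortComplexOfCompEqZero f g hfg.linearMap_comp_eq_zero).ShortExact :=
  ModuleCat.shortComplex_shortExact _ hfg hf hg

theorem subsingleton_ext_middle (hf : Function.Injective f) (hfg : Function.Exact f g)
    (hg : Function.Surjective g) {Y : ModuleCat.{u} R} {n : ℕ}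
    (hM : Subsingleton (Abelian.Ext (ModuleCat.of R M) Y n))
    (hL : Subsingleton (Abelian.Ext (ModuleCat.of R L) Y n)) :
    Subsingleton (Abelian.Ext (ModuleCat.of R N) Y n) := by
  refine subsingleton_of_forall_eq 0 fun c => ?_
  obtain ⟨b, rfl⟩ := Abelian.Ext.contravariant_sequence_exact₂
    (shortExact_of_exact hf hfg hg) Y c (hM.elim _ _)
  rw [show b = 0 from hL.elim _ _, Abelian.Ext.comp_zero]

theorem subsingleton_ext_right (hf : Function.Injective f) (hfg : Function.Exact f g)
    (hg : Function.Surjective g) {Y : ModuleCat.{u} R} {n : ℕ}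
    (hM : Subsingleton (Abelian.Ext (ModuleCat.of R M) Y n))
    (hN : Subsingleton (Abelian.Ext (ModuleCat.of R N) Y (n + 1))) :
    Subsingleton (Abelian.Ext (ModuleCat.of R L) Y (n + 1)) := by
  refine subsingleton_of_forall_eq 0 fun c => ?_
  obtain ⟨b, rfl⟩ := Abelian.Ext.contravariant_sequence_exact₃
    (shortExact_of_exact hf hfg hg) Y c (hN.elim _ _) (add_comm 1 n)
  rw [show b = 0 from hM.elim _ _, Abelian.Ext.comp_zero]

theorem exists_ext_extension (hf : Function.Injective f) (hfg : Function.Exact f g)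
    (hg : Function.Surjective g) {Y : ModuleCat.{u} R} {n : ℕ}
    (hL : Subsingleton (Abelian.Ext (ModuleCat.of R L) Y (n + 1)))
    (c : Abelian.Ext (ModuleCat.of R M) Y n) :
    ∃ b : Abelian.Ext (ModuleCat.of R N) Y n,
      (Abelian.Ext.mk₀ (ModuleCat.ofHom f)).comp b (zero_add n) = c :=
  Abelian.Ext.contravariant_sequence_exact₁ (shortExact_of_exact hf hfg hg) Y c (add_comm 1 n)
    (hL.elim _ _)

theorem subsingleton_ext_left (hf : Function.Injective f) (hfg : Function.Exact f g)
    (hg : Function.Surjective g) {Y : ModuleCat.{u} R} {n : ℕ}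
    (hN : Subsingleton (Abelian.Ext (ModuleCat.of R N) Y n))
    (hL : Subsingleton (Abelian.Ext (ModuleCat.of R L) Y (n + 1))) :
    Subsingleton (Abelian.Ext (ModuleCat.of R M) Y n) := by
  refine subsingleton_of_forall_eq 0 fun c => ?_
  obtain ⟨b, rfl⟩ := exists_ext_extension hf hfg hg hL c
  rw [show b = 0 from hN.elim _ _, Abelian.Ext.comp_zero]

theorem subsingleton_ext_congr (e : M ≃ₗ[R] N) {Y : ModuleCat.{u} R} {n : ℕ}
    (hN : Subsingleton (Abelian.Ext (ModuleCat.of R N) Y n)) :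
    Subsingleton (Abelian.Ext (ModuleCat.of R M) Y n) := by
  refine subsingleton_of_forall_eq 0 fun c => ?_
  rw [← Abelian.Ext.mk₀_id_comp c, ← e.toModuleIso.hom_inv_id, ← Abelian.Ext.mk₀_comp_mk₀_assoc,
    show (Abelian.Ext.mk₀ e.toModuleIso.inv).comp c (zero_add n) = 0 from hN.elim _ _,
    Abelian.Ext.comp_zero]

theorem subsingleton_ext_quotient_ofList (rs : List R) {M : Type u} [AddCommGroup M] [Module R M]
    (hrs : RingTheory.Sequence.IsWeaklyRegular M rs) {Y : ModuleCat.{u} R} {j : ℕ}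
    (h : ∀ n, j < n → Subsingleton (Abelian.Ext (ModuleCat.of R M) Y n)) :
    ∀ n, j + rs.length < n → Subsingleton
      (Abelian.Ext (ModuleCat.of R (M ⧸ (Ideal.ofList rs • (⊤ : Submodule R M)))) Y n) := by
  induction rs generalizing M j with
  | nil =>
    let e : (M ⧸ (Ideal.ofList ([] : List R) • (⊤ : Submodule R M))) ≃ₗ[R] M :=
      Submodule.quotEquivOfEqBot _ (by rw [Ideal.ofList_nil, Submodule.bot_smul])
    exact fun n hn => subsingleton_ext_congr e (h n hn)
  | cons x rs ih =>
    rw [RingTheory.Sequence.isWeaklyRegular_cons_iff] at hrs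
    intro n hn
    refine subsingleton_ext_congr (Submodule.quotOfListConsSMulTopEquivQuotSMulTopInner M x rs)
      (ih (M := QuotSMulTop x M) (j := j + 1) hrs.2 (fun n hn => ?_) n
        (by simp only [List.length_cons] at hn; lia))
    obtain ⟨n, rfl⟩ : ∃ k, n = k + 1 := ⟨n - 1, by lia⟩
    have hinj : Function.Injective (LinearMap.lsmul R M x) := hrs.1
    exact subsingleton_ext_right hinj (LinearMap.exact_lsmul_mkQ_smul_top M x)
      (Submodule.mkQ_surjective _) (h n (by lia)) (h (n + 1) (by lia))

end ExtVanishing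

section LocalRing

variable {A : Type u} [CommRing A] [IsLocalRing A]

open IsLocalRing

theorem exists_ne_zero_maximalIdeal_smul_eq_zero {V : Type*} [AddCommGroup V] [Module A V]
    [Nontrivial V] {N : ℕ} (hV : ∀ a ∈ maximalIdeal A ^ N, ∀ v : V, a • v = 0) :
    ∃ z : V, z ≠ 0 ∧ ∀ a ∈ maximalIdeal A, a • z = 0 := by
  classical
  have hex : ∃ N : ℕ, ∀ a ∈ maximalIdeal A ^ N, ∀ v : V, a • v = 0 := ⟨N, hV⟩
  obtain ⟨v₀, hv₀⟩ := exists_ne (0 : V)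
  have h0 : Nat.find hex ≠ 0 := by
    intro h
    have := Nat.find_spec hex
    rw [h, pow_zero, Ideal.one_eq_top] at this
    exact hv₀ (by simpa using this 1 trivial v₀)
  obtain ⟨k, hk⟩ := Nat.exists_eq_succ_of_ne_zero h0
  have h1 := Nat.find_min hex (m := k) (by lia)
  push Not at h1
  obtain ⟨a, ha, v, hv⟩ := h1
  refine ⟨a • v, hv, fun b hb => ?_⟩
  rw [← mul_smul]
  refine Nat.find_spec hex _ ?_ v
  rw [hk, pow_succ']
  exact Ideal.mul_mem_mul hb ha

theorem ker_toSpanSingleton_eq_maximalIdeal {V : Type*} [AddCommGroup V] [Module A V] {z : V}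
    (hz : z ≠ 0) (h : ∀ a ∈ maximalIdeal A, a • z = 0) :
    maximalIdeal A = LinearMap.ker (LinearMap.toSpanSingleton A V z) := by
  refine le_antisymm (fun a ha => h a ha) (le_maximalIdeal fun htop => hz ?_)
  have : (1 : A) ∈ LinearMap.ker (LinearMap.toSpanSingleton A V z) := htop ▸ trivial
  simpa using this

variable [IsNoetherianRing A]

/-- Over a local ring with a weakly regular sequence `rs` generating a primary ideal, a module `X` of
finite injective dimension satisfies `Ext^n(N, X) = 0` for `N` of finite length and `n > |rs|`. -/
theorem subsingleton_ext_of_length_lt {rs : List A} {N₀ n₀ : ℕ} (hmem : ∀ x ∈ rs, x ∈ maximalIdeal A)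
    (hprim : maximalIdeal A ^ N₀ ≤ Ideal.ofList rs)
    (hrs : RingTheory.Sequence.IsWeaklyRegular A rs)
    (X : ModuleCat.{u} A) [HasInjectiveDimensionLE X n₀] (n : ℕ) (hn : rs.length < n)
    (N : Type u) [AddCommGroup N] [Module A N] [Module.Finite A N]
    (hN : ∃ j, ∀ a ∈ maximalIdeal A ^ j, ∀ v : N, a • v = 0) :
    Subsingleton (Abelian.Ext (ModuleCat.of A N) X n) := by
  obtain ⟨k, hk⟩ : ∃ k, n₀ < n + k := ⟨n₀ + 1, by lia⟩
  induction k generalizing n N with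
  | zero => exact HasInjectiveDimensionLT.subsingleton X (n₀ + 1) n (by lia) _
  | succ k ih =>
    have hres : Subsingleton (Abelian.Ext (ModuleCat.of A (A ⧸ maximalIdeal A)) X n) := by
      have hB := subsingleton_ext_quotient_ofList rs hrs (Y := X) (j := 0) (fun n hn => by
        obtain ⟨n, rfl⟩ : ∃ k, n = k + 1 := ⟨n - 1, by lia⟩
        exact Abelian.Ext.subsingleton_of_projective _ _ _) n (by lia)
      have hle : Ideal.ofList rs ≤ maximalIdeal A := Ideal.span_le.2 hmem
      have hkill : ∀ a ∈ maximalIdeal A ^ N₀, ∀ v : A ⧸ (Ideal.ofList rs • (⊤ : Submodule A A)),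
          a • v = 0 := by
        intro a ha v
        obtain ⟨b, rfl⟩ := Submodule.mkQ_surjective _ v
        rw [← map_smul]
        exact (Submodule.Quotient.mk_eq_zero _).2 (Submodule.smul_mem_smul (hprim ha) trivial)
      have : Nontrivial (A ⧸ (Ideal.ofList rs • (⊤ : Submodule A A))) := by
        rw [Submodule.Quotient.nontrivial_iff]
        intro htop
        have h1 : (1 : A) ∈ Ideal.ofList rs • (⊤ : Submodule A A) := by
          rw [htop]
          trivial
        rw [smul_eq_mul, Ideal.mul_top] at h1
        exact (Ideal.ne_top_iff_one _).1 (maximalIdeal.isMaximal A).ne_top (hle h1)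
      obtain ⟨z, hz, hmz⟩ := exists_ne_zero_maximalIdeal_smul_eq_zero hkill
      have hker := ker_toSpanSingleton_eq_maximalIdeal hz hmz
      let f := (maximalIdeal A).liftQ _ hker.le
      have hf : Function.Injective f :=
        LinearMap.ker_eq_bot.mp (Submodule.ker_liftQ_eq_bot _ _ _ hker.ge)
      refine subsingleton_ext_left hf (LinearMap.exact_map_mkQ_range f) (Submodule.mkQ_surjective _)
        hB (ih (n + 1) (by lia) _ ⟨N₀, fun a ha v => ?_⟩ (by lia))
      obtain ⟨v, rfl⟩ := Submodule.mkQ_surjective _ v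
      rw [← map_smul, hkill a ha v, map_zero]
    refine IsNoetherianRing.induction_on_isQuotientEquivQuotientPrime A (M := N) inferInstance
      (motive := fun N _ _ _ => (∃ j, ∀ a ∈ maximalIdeal A ^ j, ∀ v : N, a • v = 0) →
        Subsingleton (Abelian.Ext (ModuleCat.of A N) X n)) ?_ ?_ ?_ hN
    · intro N _ _ _ _ _
      have hz : IsZero (ModuleCat.of A N) := ModuleCat.isZero_of_subsingleton _
      refine subsingleton_of_forall_eq 0 fun c => ?_
      rw [← Abelian.Ext.mk₀_id_comp c, hz.eq_of_src (𝟙 _) 0, Abelian.Ext.mk₀_zero,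
        Abelian.Ext.zero_comp]
    · rintro N _ _ _ p e ⟨j, hj⟩
      refine subsingleton_ext_congr e ?_
      have hp : p.1 = maximalIdeal A := by
        refine le_antisymm (le_maximalIdeal p.2.ne_top) (p.2.le_of_pow_le (n := j) fun a ha => ?_)
        have := hj a ha (e.symm (Submodule.Quotient.mk 1))
        rw [← map_smul, e.symm.map_eq_zero_iff, ← Submodule.Quotient.mk_smul,
          Submodule.Quotient.mk_eq_zero] at this
        simpa using this
      rw [hp]
      exact hres
    · rintro N₁ _ _ _ N₂ _ _ _ N₃ _ _ _ f g hf hg hfg h1 h3 ⟨j, hj⟩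
      refine subsingleton_ext_middle hf hfg hg (h1 ⟨j, fun a ha v => hf ?_⟩)
        (h3 ⟨j, fun a ha v => ?_⟩)
      · rw [map_smul, hj a ha, map_zero]
      · obtain ⟨v, rfl⟩ := hg v
        rw [← map_smul, hj a ha, map_zero]

/-- With `rs` and `X` as above, `X/rs` is an injective module over `A/rs`. -/
theorem exists_extension_quotient {rs : List A} {N₀ n₀ : ℕ} (hmem : ∀ x ∈ rs, x ∈ maximalIdeal A)
    (hprim : maximalIdeal A ^ N₀ ≤ Ideal.ofList rs)
    (hrs : RingTheory.Sequence.IsWeaklyRegular A rs) {X : Type u} [AddCommGroup X] [Module A X]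
    [HasInjectiveDimensionLE (ModuleCat.of A X) n₀]
    (hX : RingTheory.Sequence.IsWeaklyRegular X rs)
    (J : Submodule A (A ⧸ Ideal.ofList rs))
    (f : J →ₗ[A] (X ⧸ (Ideal.ofList rs • (⊤ : Submodule A X)))) :
    ∃ g : (A ⧸ Ideal.ofList rs) →ₗ[A] (X ⧸ (Ideal.ofList rs • (⊤ : Submodule A X))),
      g ∘ₗ J.subtype = f := by
  obtain ⟨c, hc⟩ := exists_ext_class rs hX
  have hB (a : A) (ha : a ∈ Ideal.ofList rs) (v : A ⧸ Ideal.ofList rs) : a • v = 0 := by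
    obtain ⟨b, rfl⟩ := Submodule.mkQ_surjective _ v
    rw [← map_smul]
    exact (Submodule.Quotient.mk_eq_zero _).2 (Ideal.mul_mem_right _ _ ha)
  have hrsB (x : A) (hx : x ∈ rs) (v : A ⧸ Ideal.ofList rs) : x • v = 0 :=
    hB x (Ideal.subset_span hx) v
  have hL := subsingleton_ext_of_length_lt hmem hprim hrs (ModuleCat.of A X) (n₀ := n₀)
    (rs.length + 1) (by lia) ((A ⧸ Ideal.ofList rs) ⧸ J) ⟨N₀, fun a ha v => by
      obtain ⟨v, rfl⟩ := Submodule.mkQ_surjective _ v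
      rw [← map_smul, hB a (hprim ha) v, map_zero]⟩
  obtain ⟨b, hb⟩ := exists_ext_extension J.injective_subtype (LinearMap.exact_subtype_mkQ J)
    (Submodule.mkQ_surjective J) hL
    ((Abelian.Ext.mk₀ (ModuleCat.ofHom f)).comp c (zero_add _))
  obtain ⟨g, rfl⟩ := (hc _ hrsB).2 b
  refine ⟨g.hom, ?_⟩
  have h2 : ModuleCat.ofHom J.subtype ≫ g = ModuleCat.ofHom f := by
    refine (hc J fun x hx v => Subtype.ext ?_).1 ?_
    · exact hrsB x hx v
    · exact (Abelian.Ext.mk₀_comp_mk₀_assoc _ _ _).symm.trans hb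
  exact congrArg ModuleCat.Hom.hom h2

end LocalRing

section QuotientInjective

/-- Baer's criterion over the ring `A ⧸ I`, formulated for `A`-modules annihilated by `I`. -/
theorem exists_extension_of_smul_eq_zero {A : Type u} [CommRing A] (I : Ideal A)
    {V W Q : Type u} [AddCommGroup V] [Module A V] [AddCommGroup W] [Module A W]
    [AddCommGroup Q] [Module A Q]
    (hQ : ∀ a ∈ I, ∀ y : Q, a • y = 0) (hV : ∀ a ∈ I, ∀ y : V, a • y = 0)
    (hext : ∀ (J : Submodule A (A ⧸ I)) (f : J →ₗ[A] Q), ∃ g : (A ⧸ I) →ₗ[A] Q,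
      g ∘ₗ J.subtype = f)
    (i : W →ₗ[A] V) (hi : Function.Injective i) (f : W →ₗ[A] Q) :
    ∃ g : V →ₗ[A] Q, g ∘ₗ i = f := by
  have hQ' : Module.IsTorsionBySet A Q I := fun y a => hQ a a.2 y
  have hV' : Module.IsTorsionBySet A V I := fun y a => hV a a.2 y
  have hW' : Module.IsTorsionBySet A W I := fun y a => hi (by
    rw [map_smul, map_zero]
    exact hV a a.2 _)
  let _ : Module (A ⧸ I) Q := hQ'.module
  let _ : Module (A ⧸ I) V := hV'.module
  let _ : Module (A ⧸ I) W := hW'.module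
  have : IsScalarTower A (A ⧸ I) Q := hQ'.isScalarTower
  have : IsScalarTower A (A ⧸ I) V := hV'.isScalarTower
  have : IsScalarTower A (A ⧸ I) W := hW'.isScalarTower
  have hsurj : Function.Surjective (algebraMap A (A ⧸ I)) := Ideal.Quotient.mk_surjective
  have hbaer : Module.Baer (A ⧸ I) Q := by
    intro J g
    obtain ⟨g', hg'⟩ := hext (J.restrictScalars A) (g.restrictScalars A)
    exact ⟨g'.extendScalarsOfSurjective hsurj, fun x hx => LinearMap.congr_fun hg' ⟨x, hx⟩⟩
  obtain ⟨g, hg⟩ := hbaer.extension_property (i.extendScalarsOfSurjective hsurj) hi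
    (f.extendScalarsOfSurjective hsurj)
  exact ⟨g.restrictScalars A, LinearMap.ext fun x => LinearMap.congr_fun hg x⟩

variable {A : Type u} [CommRing A] [IsLocalRing A]

open IsLocalRing

/-- If `Q` is an `A/I`-module with the injectivity property and with only homotheties as
endomorphisms, then `Q` is isomorphic to the `I`-torsion of the injective hull `E` of the residue
field; consequently `Hom(Q, E) ≅ Hom(Q, Q)`. -/
theorem nonempty_linearMap_equiv_end {I : Ideal A} {N₀ : ℕ} (hI : maximalIdeal A ^ N₀ ≤ I)
    {Q E : Type u} [AddCommGroup Q] [Module A Q] [Nontrivial Q] [AddCommGroup E] [Module A E]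
    [Module.Injective A E]
    (hQ : ∀ a ∈ I, ∀ y : Q, a • y = 0)
    (hext : ∀ (J : Submodule A (A ⧸ I)) (f : J →ₗ[A] Q), ∃ g : (A ⧸ I) →ₗ[A] Q,
      g ∘ₗ J.subtype = f)
    (hend : ∀ φ : Q →ₗ[A] Q, ∃ a : A, φ = a • LinearMap.id)
    {e : E} (he : ∀ a : A, a • e = 0 ↔ a ∈ maximalIdeal A)
    (hess : ∀ x : E, x ≠ 0 → ∃ a : A, a • x = e) :
    Nonempty ((Q →ₗ[A] E) ≃ₗ[A] (Q →ₗ[A] Q)) := by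
  have hle : I ≤ maximalIdeal A := le_maximalIdeal fun h => by
    obtain ⟨y, hy⟩ := exists_ne (0 : Q)
    exact hy (by simpa using hQ 1 (h ▸ trivial) y)
  obtain ⟨z, hz, hmz⟩ := exists_ne_zero_maximalIdeal_smul_eq_zero (V := Q) (N := N₀)
    fun a ha v => hQ a (hI ha) v
  let V := Submodule.torsionBySet A E I
  have hV (a : A) (ha : a ∈ I) (y : V) : a • y = 0 :=
    Subtype.ext ((Submodule.mem_torsionBySet_iff _ _).1 y.2 ⟨a, ha⟩)
  let eV : V := ⟨e, (Submodule.mem_torsionBySet_iff _ _).2 fun a => (he a).2 (hle a.2)⟩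
  have he0 : e ≠ 0 := fun h => (maximalIdeal.isMaximal A).ne_top
    ((Ideal.eq_top_iff_one _).2 ((he 1).1 (by rw [h, smul_zero])))
  have hkE := ker_toSpanSingleton_eq_maximalIdeal (z := eV)
    (fun h => he0 (congrArg Subtype.val h)) fun a ha => Subtype.ext ((he a).2 ha)
  have hkz := ker_toSpanSingleton_eq_maximalIdeal hz hmz
  obtain ⟨h, hh⟩ := exists_extension_of_smul_eq_zero I hQ hV hext
    ((maximalIdeal A).liftQ _ hkE.le)
    (LinearMap.ker_eq_bot.mp (Submodule.ker_liftQ_eq_bot _ _ _ hkE.ge))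
    ((maximalIdeal A).liftQ _ hkz.le)
  have hez : h eV = z := by
    have := LinearMap.congr_fun hh (Submodule.Quotient.mk 1)
    rw [LinearMap.comp_apply, Submodule.liftQ_apply (h := hkE.le),
      Submodule.liftQ_apply (h := hkz.le)] at this
    simpa using this
  have hinj : Function.Injective h := by
    refine (injective_iff_map_eq_zero h).2 fun x hx => ?_
    by_contra hx0
    obtain ⟨a, ha⟩ := hess x fun hx => hx0 (Subtype.ext hx)
    have : a • x = eV := Subtype.ext ha
    rw [← hez, ← this, map_smul, hx, smul_zero] at hz
    exact hz rfl
  obtain ⟨ρ, hρ⟩ := Module.Injective.out h hinj V.subtype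
  have hmem (f : Q →ₗ[A] E) (y : Q) : f y ∈ V := (Submodule.mem_torsionBySet_iff _ _).2
    fun a => by
      show (a : A) • f y = 0
      rw [← map_smul, hQ a a.2, map_zero]
  obtain ⟨a, ha⟩ := hend (h ∘ₗ ρ.codRestrict V (hmem ρ))
  have hπ (v : V) : ρ.codRestrict V (hmem ρ) (h v) = v := Subtype.ext (hρ v)
  have haz : (a - 1) • z = 0 := by
    have := LinearMap.congr_fun ha z
    rw [LinearMap.comp_apply, ← hez, hπ, hez] at this
    rw [sub_smul, one_smul, sub_eq_zero]
    exact this.symm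
  have hunit : IsUnit a := by
    by_contra hna
    have hu : IsUnit (a - 1) := by
      have := IsLocalRing.isUnit_or_isUnit_of_add_one (a := a) (b := - (a - 1))
      grind [IsUnit.neg_iff]
    exact hz ((hu.smul_eq_zero).1 haz)
  have hsurj : Function.Surjective h := fun y => by
    obtain ⟨b, hb⟩ := hunit.exists_right_inv
    refine ⟨ρ.codRestrict V (hmem ρ) (b • y), ?_⟩
    have := LinearMap.congr_fun ha (b • y)
    rw [LinearMap.comp_apply] at this
    rw [this, LinearMap.smul_apply, LinearMap.id_apply, smul_smul, hb, one_smul]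
  let hE := LinearEquiv.ofBijective h ⟨hinj, hsurj⟩
  refine ⟨(LinearEquiv.ofBijective
    ((V.subtype ∘ₗ hE.symm.toLinearMap).compRight A : (Q →ₗ[A] Q) →ₗ[A] (Q →ₗ[A] E))
    ⟨fun φ ψ hφ => ?_, fun f => ⟨h ∘ₗ f.codRestrict V (hmem f), ?_⟩⟩).symm⟩
  · ext y
    exact hE.symm.injective (V.injective_subtype (LinearMap.congr_fun hφ y))
  · ext y
    exact congrArg Subtype.val (hE.symm_apply_apply (f.codRestrict V (hmem f) y))

end QuotientInjective

section Translation

variable {R : Type u} [CommRing R]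

theorem subsingleton_abelianExt_of_extM {M N : Type u} [AddCommGroup M] [Module R M]
    [AddCommGroup N] [Module R N] (i : ℕ) (h : Subsingleton (ExtM R (i + 1) M N)) :
    Subsingleton (Abelian.Ext (ModuleCat.of R M) (ModuleCat.of R N) (i + 1)) := by
  let P := projectiveResolution (ModuleCat.of R M)
  have hz : IsZero ((P.complex.linearYonedaObj R (ModuleCat.of R N)).homology (i + 1)) :=
    IsZero.of_iso (ModuleCat.isZero_of_subsingleton _) (P.isoExt (R := R) (i + 1) _).symm
  rw [← HomologicalComplex.exactAt_iff_isZero_homology,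
    HomologicalComplex.exactAt_iff' _ i (i + 1) (i + 2) (by simp) (by simp),
    ShortComplex.moduleCat_exact_iff] at hz
  refine subsingleton_of_forall_eq 0 fun c => ?_
  obtain ⟨f, hf, rfl⟩ := P.extMk_surjective c (i + 2) rfl
  rw [P.extMk_eq_zero_iff f (i + 2) rfl hf i rfl]
  obtain ⟨g, hg⟩ := hz f hf
  exact ⟨g, hg⟩

end Translation

section LocalizeExt

variable {R : Type u} [CommRing R] [IsNoetherianRing R] (S : Submonoid R)
  {A : Type u} [CommRing A] [Algebra R A] [IsLocalization S A]
  {D X : Type u} [AddCommGroup D] [Module R D] [AddCommGroup X] [Module R X] [Module A X]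
  [IsScalarTower R A X] (fX : D →ₗ[R] X) [IsLocalizedModule S fX]

include fX in
theorem exists_extension_of_isLocalizedModule {K F K' F' : Type u}
    [AddCommGroup K] [Module R K] [Module.Finite R K] [AddCommGroup F] [Module R F]
    [AddCommGroup K'] [Module R K'] [Module A K'] [IsScalarTower R A K']
    [AddCommGroup F'] [Module R F'] [Module A F'] [IsScalarTower R A F']
    (fK : K →ₗ[R] K') [IsLocalizedModule S fK] (fF : F →ₗ[R] F') [IsLocalizedModule S fF]
    (i : K →ₗ[R] F) (h : ∀ φ : K →ₗ[R] D, ∃ ψ : F →ₗ[R] D, ψ ∘ₗ i = φ) (φ : K' →ₗ[A] X) :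
    ∃ ψ : F' →ₗ[A] X, ψ ∘ₗ IsLocalizedModule.mapExtendScalars S fK fF A i = φ := by
  have : Module.FinitePresentation R K := Module.finitePresentation_of_finite R K
  obtain ⟨φ₀, s, hs⟩ := Module.FinitePresentation.exists_lift_of_isLocalizedModule S fX
    (φ.restrictScalars R ∘ₗ fK)
  obtain ⟨ψ₀, rfl⟩ := h φ₀
  refine ⟨IsLocalization.mk' A 1 s • IsLocalizedModule.mapExtendScalars S fF fX A ψ₀, ?_⟩
  apply LinearMap.restrictScalars_injective R
  refine IsLocalizedModule.linearMap_ext S fK fX (LinearMap.ext fun k => ?_)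
  have hk : fX (ψ₀ (i k)) = (s : R) • φ (fK k) := LinearMap.congr_fun hs k
  have : IsLocalization.mk' A 1 s • (s : R) • φ (fK k) = φ (fK k) := by
    rw [← algebraMap_smul A (s : R), smul_smul, IsLocalization.mk'_spec, map_one, one_smul]
  simpa [hk] using this

theorem exists_isLocalizedModule {R : Type u} [CommRing R] (S : Submonoid R) (A : Type u)
    [CommRing A] [Algebra R A] [IsLocalization S A] (K : Type u) [AddCommGroup K] [Module R K] :
    ∃ (K' : Type u) (_ : AddCommGroup K') (_ : Module R K') (_ : Module A K')
      (_ : IsScalarTower R A K') (fK : K →ₗ[R] K'), IsLocalizedModule S fK :=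
  ⟨TensorProduct R A K, inferInstance, inferInstance, inferInstance, inferInstance,
    TensorProduct.mk R A K 1,
    (isLocalizedModule_iff_isBaseChange S A _).2 (TensorProduct.isBaseChange R K A)⟩

theorem subsingleton_ext_one_of_exists_extension {B : Type u} [CommRing B]
    {K F N : Type u} [AddCommGroup K] [Module B K] [AddCommGroup F] [Module B F] [AddCommGroup N]
    [Module B N] [Module.Projective B F] {i : K →ₗ[B] F} {π : F →ₗ[B] N}
    (hi : Function.Injective i) (hex : Function.Exact i π) (hπ : Function.Surjective π)
    {Y : Type u} [AddCommGroup Y] [Module B Y] (h : ∀ φ : K →ₗ[B] Y, ∃ ψ : F →ₗ[B] Y, ψ ∘ₗ i = φ) :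
    Subsingleton (Abelian.Ext (ModuleCat.of B N) (ModuleCat.of B Y) 1) := by
  have hS := shortExact_of_exact hi hex hπ
  refine subsingleton_of_forall_eq 0 fun c => ?_
  have : Projective (ModuleCat.of B F) := inferInstance
  obtain ⟨b, rfl⟩ := Abelian.Ext.contravariant_sequence_exact₃ hS _ c
    (Abelian.Ext.eq_zero_of_projective (P := ModuleCat.of B F) _) (add_zero 1)
  obtain ⟨φ, rfl⟩ := (Abelian.Ext.mk₀_bijective _ _).2 b
  obtain ⟨ψ, hψ⟩ := h φ.hom
  have : φ = ModuleCat.ofHom i ≫ ModuleCat.ofHom ψ := by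
    ext : 1
    exact hψ.symm
  rw [this, ← Abelian.Ext.mk₀_comp_mk₀]
  exact hS.extClass_comp_assoc _

include fX in
theorem subsingleton_ext_of_isLocalizedModule (n : ℕ) {N N' : Type u}
    [AddCommGroup N] [Module R N] [Module.Finite R N]
    [AddCommGroup N'] [Module R N'] [Module A N'] [IsScalarTower R A N']
    (fN : N →ₗ[R] N') [IsLocalizedModule S fN]
    (h : Subsingleton (Abelian.Ext (ModuleCat.of R N) (ModuleCat.of R D) (n + 1))) :
    Subsingleton (Abelian.Ext (ModuleCat.of A N') (ModuleCat.of A X) (n + 1)) := by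
  induction n generalizing N N' with
  | zero =>
    obtain ⟨m, π, hπ⟩ := Module.Finite.exists_fin' R N
    let i := (LinearMap.ker π).subtype
    have hi : Function.Injective i := Submodule.injective_subtype _
    have hex : Function.Exact i π := LinearMap.exact_subtype_ker_map π
    obtain ⟨K', _, _, _, _, fK, _⟩ := exists_isLocalizedModule S A (LinearMap.ker π)
    obtain ⟨F', _, _, _, _, fF, _⟩ := exists_isLocalizedModule S A (Fin m → R)
    have : Module.Projective A F' :=
      Module.projective_of_isLocalizedModule S fF
    refine subsingleton_ext_one_of_exists_extension
      (i := IsLocalizedModule.mapExtendScalars S fK fF A i)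
      (π := IsLocalizedModule.mapExtendScalars S fF fN A π)
      (IsLocalizedModule.map_injective S fK fF i hi)
      (IsLocalizedModule.map_exact S fK fF fN i π hex)
      (IsLocalizedModule.map_surjective S fF fN π hπ)
      (exists_extension_of_isLocalizedModule S fX fK fF i fun φ => ?_)
    obtain ⟨b, hb⟩ := exists_ext_extension hi hex hπ h (Abelian.Ext.mk₀ (ModuleCat.ofHom φ))
    obtain ⟨ψ, rfl⟩ := (Abelian.Ext.mk₀_bijective _ _).2 b
    rw [Abelian.Ext.mk₀_comp_mk₀] at hb
    exact ⟨ψ.hom, congrArg ModuleCat.Hom.hom ((Abelian.Ext.mk₀_bijective _ _).1 hb)⟩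
  | succ n ih =>
    obtain ⟨m, π, hπ⟩ := Module.Finite.exists_fin' R N
    let i := (LinearMap.ker π).subtype
    have hi : Function.Injective i := Submodule.injective_subtype _
    have hex : Function.Exact i π := LinearMap.exact_subtype_ker_map π
    obtain ⟨K', _, _, _, _, fK, _⟩ := exists_isLocalizedModule S A (LinearMap.ker π)
    obtain ⟨F', _, _, _, _, fF, _⟩ := exists_isLocalizedModule S A (Fin m → R)
    have : Module.Projective A F' :=
      Module.projective_of_isLocalizedModule S fF
    exact subsingleton_ext_right
      (f := IsLocalizedModule.mapExtendScalars S fK fF A i)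
      (g := IsLocalizedModule.mapExtendScalars S fF fN A π)
      (IsLocalizedModule.map_injective S fK fF i hi)
      (IsLocalizedModule.map_exact S fK fF fN i π hex)
      (IsLocalizedModule.map_surjective S fF fN π hπ)
      (ih fK (subsingleton_ext_left hi hex hπ (Abelian.Ext.subsingleton_of_projective _ _ _) h))
      (Abelian.Ext.subsingleton_of_projective _ _ _)

include S fX in
theorem bijective_smul_id_of_isLocalizedModule [Module.Finite R D]
    (h : Function.Bijective (fun r : R => (r • LinearMap.id : D →ₗ[R] D))) :
    Function.Bijective (fun a : A => (a • LinearMap.id : X →ₗ[A] X)) := by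
  have : Module.FinitePresentation R D := Module.finitePresentation_of_finite R D
  let e : R ≃ₗ[R] (D →ₗ[R] D) :=
    LinearEquiv.ofBijective (LinearMap.toSpanSingleton R _ LinearMap.id) h
  let g := IsLocalizedModule.mapExtendScalars S fX fX A ∘ₗ e.toLinearMap
  have : IsLocalizedModule S g := IsLocalizedModule.of_linearEquiv_right _ _ _
  let e' := IsLocalizedModule.linearEquiv S (Algebra.linearMap R A) g
  have he' : e'.toLinearMap =
      (LinearMap.toSpanSingleton A (X →ₗ[A] X) LinearMap.id).restrictScalars R := by
    refine IsLocalizedModule.linearMap_ext S (Algebra.linearMap R A) g (LinearMap.ext fun r => ?_)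
    have h1 : e' (Algebra.linearMap R A r) = g r := IsLocalizedModule.linearEquiv_apply ..
    refine h1.trans ?_
    apply LinearMap.restrictScalars_injective R
    refine IsLocalizedModule.linearMap_ext S fX fX (LinearMap.ext fun x => ?_)
    have hr : e r x = r • x := rfl
    simp [g, hr]
  have := e'.bijective
  have h2 : (fun a : A => (a • LinearMap.id : X →ₗ[A] X)) = e' := by
    funext a
    exact (LinearMap.congr_fun he' a).symm
  rw [h2]
  exact this

theorem hasInjectiveDimensionLE_of_isLocalizedModule (n : ℕ) (M : ModuleCat.{u} R) {M' : Type u}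
    [AddCommGroup M'] [Module R M'] [Module A M'] [IsScalarTower R A M'] (fM : M →ₗ[R] M')
    [IsLocalizedModule S fM] (h : InjDimLE R n M) :
    HasInjectiveDimensionLE (ModuleCat.of A M') n := by
  induction n generalizing M M' with
  | zero =>
    have : Module.Injective R M := h
    have : Injective (ModuleCat.of A M') := (Module.injective_iff_injective_object A M').1
      (Module.injective_of_isLocalizedModule S fM)
    infer_instance
  | succ n ih =>
    obtain ⟨I, hI, ι, hι, h⟩ := h
    obtain ⟨I', _, _, _, _, fI, _⟩ := exists_isLocalizedModule S A I
    obtain ⟨C', _, _, _, _, fC, _⟩ := exists_isLocalizedModule S A (I ⧸ LinearMap.range ι)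
    have : Injective (ModuleCat.of A I') := (Module.injective_iff_injective_object A I').1
      (Module.injective_of_isLocalizedModule S fI)
    have hS := shortExact_of_exact
      (f := IsLocalizedModule.mapExtendScalars S fM fI A ι)
      (g := IsLocalizedModule.mapExtendScalars S fI fC A (Submodule.mkQ _))
      (IsLocalizedModule.map_injective S fM fI ι hι)
      (IsLocalizedModule.map_exact S fM fI fC _ _ (LinearMap.exact_map_mkQ_range ι))
      (IsLocalizedModule.map_surjective S fI fC _ (Submodule.mkQ_surjective _))
    have := ih (ModuleCat.of R (I ⧸ LinearMap.range ι)) fC h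
    exact hS.hasInjectiveDimensionLT_X₁ (n + 1) this inferInstance

end LocalizeExt

theorem exists_maximalIdeal_pow_le_ofList {A : Type u} [CommRing A] [IsLocalRing A]
    [IsNoetherianRing A] {rs : List A} (hmem : ∀ x ∈ rs, x ∈ IsLocalRing.maximalIdeal A)
    (hrs : RingTheory.Sequence.IsRegular A rs) (hdim : ringKrullDim A = rs.length) :
    ∃ N : ℕ, IsLocalRing.maximalIdeal A ^ N ≤ Ideal.ofList rs := by
  have hle : Ideal.ofList rs ≤ IsLocalRing.maximalIdeal A := Ideal.span_le.mpr hmem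
  have hne : Ideal.ofList rs ≠ ⊤ := fun h =>
    (IsLocalRing.maximalIdeal.isMaximal A).ne_top (top_le_iff.mp (h ▸ hle))
  have : Nontrivial (A ⧸ Ideal.ofList rs) := Ideal.Quotient.nontrivial_iff.mpr hne
  have : IsLocalRing (A ⧸ Ideal.ofList rs) :=
    IsLocalRing.of_surjective' (Ideal.Quotient.mk _) Ideal.Quotient.mk_surjective
  have h := ringKrullDim_add_length_eq_ringKrullDim_of_isRegular rs hrs
  have h0 : ringKrullDim (A ⧸ Ideal.ofList rs) = 0 := by
    rw [hdim] at h
    have h1 : ringKrullDim (A ⧸ Ideal.ofList rs) ≠ ⊥ := ringKrullDim_ne_bot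
    generalize ringKrullDim (A ⧸ Ideal.ofList rs) = z at h h1
    cases z with
    | bot => exact absurd rfl h1
    | coe z =>
      have h2 : z + (rs.length : ℕ∞) = rs.length := by exact_mod_cast h
      have h3 : z = 0 := by
        cases z with
        | top => simp at h2
        | coe z => norm_cast at h2 ⊢; omega
      rw [h3]; rfl
  rw [← ringKrullDimZero_iff_ringKrullDim_eq_zero, ← isArtinianRing_iff_krullDimLE_zero,
    isArtinianRing_iff_isNilpotent_maximalIdeal] at h0
  obtain ⟨N, hN⟩ := h0
  refine ⟨N, ?_⟩
  have h4 : (IsLocalRing.maximalIdeal A).map (Ideal.Quotient.mk (Ideal.ofList rs)) ≤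
      IsLocalRing.maximalIdeal (A ⧸ Ideal.ofList rs) := by
    refine IsLocalRing.le_maximalIdeal ?_
    intro h5
    have := Ideal.comap_map_of_surjective' (Ideal.Quotient.mk (Ideal.ofList rs))
      Ideal.Quotient.mk_surjective (IsLocalRing.maximalIdeal A)
    rw [h5, Ideal.comap_top, Ideal.mk_ker, sup_eq_left.mpr hle] at this
    exact (IsLocalRing.maximalIdeal.isMaximal A).ne_top this.symm
  have h6 : (IsLocalRing.maximalIdeal A ^ N).map (Ideal.Quotient.mk (Ideal.ofList rs)) = ⊥ := by
    rw [Ideal.map_pow, eq_bot_iff]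
    exact (Ideal.pow_right_mono h4 N).trans hN.le
  rwa [Ideal.map_eq_bot_iff_le_ker, Ideal.mk_ker] at h6

theorem exists_isRegular_length_eq_height {A : Type u} [CommRing A] [IsLocalRing A]
    [IsNoetherianRing A] (h : (localRingDepth A : WithBot ℕ∞) = ringKrullDim A) :
    ∃ rs : List A, (∀ r ∈ rs, r ∈ IsLocalRing.maximalIdeal A) ∧
      RingTheory.Sequence.IsRegular A rs ∧ ringKrullDim A = rs.length := by
  have hlt : localRingDepth A < ⊤ := by
    have : ringKrullDim A < ⊤ := ringKrullDim_lt_top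
    rw [← h] at this
    exact WithBot.coe_lt_coe.mp this
  have hne : Nonempty {n : ℕ∞ | ∃ rs : List A, (∀ r ∈ rs, r ∈ IsLocalRing.maximalIdeal A) ∧
      RingTheory.Sequence.IsRegular A rs ∧ (rs.length : ℕ∞) = n} :=
    ⟨0, [], by simp, RingTheory.Sequence.IsRegular.nil A A, by simp⟩
  obtain ⟨rs, h1, h2, h3⟩ := ENat.sSup_mem_of_nonempty_of_lt_top hlt
  refine ⟨rs, h1, h2, ?_⟩
  rw [← h]
  change ((sSup _ : ℕ∞) : WithBot ℕ∞) = _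
  rw [← h3]; rfl

theorem exists_list_of_isWeaklyRegular_atPrime {R : Type u} [CommRing R] (p : Ideal R) [p.IsPrime]
    {A : Type u} [CommRing A] [Algebra R A] [IsLocalization.AtPrime A p] [IsLocalRing A]
    (rs : List A) :
    ∀ (M : Type u) [AddCommGroup M] [Module A M],
    (∀ r ∈ rs, r ∈ IsLocalRing.maximalIdeal A) → RingTheory.Sequence.IsWeaklyRegular M rs →
    ∃ ss : List R, (∀ r ∈ ss, r ∈ p) ∧ ss.length = rs.length ∧
      RingTheory.Sequence.IsWeaklyRegular M (ss.map (algebraMap R A)) ∧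
      Ideal.ofList (ss.map (algebraMap R A)) = Ideal.ofList rs := by
  induction rs with
  | nil => intro M _ _ _ _; exact ⟨[], by simp, rfl, by simp, by simp⟩
  | cons a rs ih =>
    intro M _ _ hmem hreg
    rw [RingTheory.Sequence.isWeaklyRegular_cons_iff] at hreg
    obtain ⟨r, s, rfl⟩ := IsLocalization.exists_mk'_eq p.primeCompl a
    have hr : r ∈ p := (IsLocalization.AtPrime.mk'_mem_maximal_iff A p r s).mp (hmem _ (by simp))
    obtain ⟨ss, h1, h2, h3, h4⟩ := ih _ (fun x hx => hmem x (by simp [hx])) hreg.2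
    have hu : IsUnit (algebraMap R A s) := IsLocalization.map_units A s
    have hmul : algebraMap R A r = IsLocalization.mk' A r s * algebraMap R A s :=
      (IsLocalization.mk'_spec A r s).symm
    refine ⟨r :: ss, ?_, by simp [h2], ?_, ?_⟩
    · intro x hx
      rcases List.mem_cons.mp hx with rfl | hx
      · exact hr
      · exact h1 x hx
    · rw [List.map_cons, RingTheory.Sequence.isWeaklyRegular_cons_iff]
      constructor
      · rw [hmul]
        exact IsSMulRegular.mul hreg.1 (hu.isSMulRegular M)
      · have heq : IsLocalization.mk' A r s • (⊤ : Submodule A M) =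
            algebraMap R A r • (⊤ : Submodule A M) := by
          apply le_antisymm
          · intro x hx
            obtain ⟨y, -, rfl⟩ := Submodule.mem_smul_pointwise_iff_exists _ _ _ |>.mp hx
            obtain ⟨u, hu'⟩ := hu
            refine Submodule.mem_smul_pointwise_iff_exists _ _ _ |>.mpr
              ⟨((u⁻¹ : Aˣ) : A) • y, trivial, ?_⟩
            rw [hmul, ← hu', smul_smul, mul_assoc, Units.mul_inv, mul_one]
          · intro x hx
            obtain ⟨y, -, rfl⟩ := Submodule.mem_smul_pointwise_iff_exists _ _ _ |>.mp hx
            refine Submodule.mem_smul_pointwise_iff_exists _ _ _ |>.mpr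
              ⟨algebraMap R A s • y, trivial, ?_⟩
            rw [hmul, smul_smul]
        exact (LinearEquiv.isWeaklyRegular_congr (Submodule.quotEquivOfEq _ _ heq) _).mp h3
    · rw [List.map_cons, Ideal.ofList_cons, Ideal.ofList_cons, h4, hmul,
        Ideal.span_singleton_mul_right_unit hu]

theorem IsCohenMacaulayRing.exists_list {R : Type u} [CommRing R] [IsNoetherianRing R]
    (hCM : IsCohenMacaulayRing R) (p : Ideal R) (hp : p.IsPrime) :
    ∃ rs : List R, (∀ r ∈ rs, r ∈ p) ∧
      (rs.length : ℕ∞) = Order.height (⟨p, hp⟩ : PrimeSpectrum R) ∧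
      RingTheory.Sequence.IsWeaklyRegular (Localization.AtPrime p) rs ∧
      ∃ N : ℕ, IsLocalRing.maximalIdeal (Localization.AtPrime p) ^ N ≤
        Ideal.ofList (rs.map (algebraMap R (Localization.AtPrime p))) := by
  have : IsNoetherianRing (Localization.AtPrime p) :=
    IsLocalization.isNoetherianRing p.primeCompl _ inferInstance
  obtain ⟨rs, h1, h2, h3⟩ := exists_isRegular_length_eq_height (hCM p hp)
  obtain ⟨N, hN⟩ := exists_maximalIdeal_pow_le_ofList h1 h2 h3
  obtain ⟨ss, h4, h5, h6, h7⟩ :=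
    exists_list_of_isWeaklyRegular_atPrime p rs (Localization.AtPrime p) h1 h2.toIsWeaklyRegular
  refine ⟨ss, h4, ?_, ?_, N, h7 ▸ hN⟩
  · rw [← PrimeSpectrum.height_eq_orderHeight, h5]
    have := IsLocalization.AtPrime.ringKrullDim_eq_height p (Localization.AtPrime p)
    rw [h3] at this
    exact_mod_cast this
  · rwa [RingTheory.Sequence.isWeaklyRegular_map_algebraMap_iff] at h6

theorem nonempty_linearMap_quotient_equiv {A : Type u} [CommRing A] [IsLocalRing A]
    [IsNoetherianRing A] {X : Type u} [AddCommGroup X] [Module A X] [Module.Finite A X]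
    (hbij : Function.Bijective (fun r : A => (r • LinearMap.id : X →ₗ[A] X)))
    (hext : ∀ i, 1 ≤ i → Subsingleton (Abelian.Ext (ModuleCat.of A X) (ModuleCat.of A X) i))
    {n₀ : ℕ} [HasInjectiveDimensionLE (ModuleCat.of A X) n₀]
    {rs : List A} {N₀ : ℕ} (hmem : ∀ x ∈ rs, x ∈ IsLocalRing.maximalIdeal A)
    (hprim : IsLocalRing.maximalIdeal A ^ N₀ ≤ Ideal.ofList rs)
    (hrs : RingTheory.Sequence.IsWeaklyRegular A rs)
    {E : Type u} [AddCommGroup E] [Module A E] [Module.Injective A E]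
    {e : E} (he : ∀ a : A, a • e = 0 ↔ a ∈ IsLocalRing.maximalIdeal A)
    (hess : ∀ x : E, x ≠ 0 → ∃ a : A, a • x = e) :
    RingTheory.Sequence.IsWeaklyRegular X rs ∧
      Nonempty (((X ⧸ Ideal.ofList rs • (⊤ : Submodule A X)) →ₗ[A] E) ≃ₗ[A]
        A ⧸ Ideal.ofList rs • (⊤ : Submodule A A)) := by
  obtain ⟨hX, ε, hε⟩ := exists_equiv_end_quotient hbij hext rs hrs
  refine ⟨hX, ?_⟩
  have hle : Ideal.ofList rs ≤ IsLocalRing.maximalIdeal A := Ideal.span_le.mpr hmem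
  have hne : Ideal.ofList rs • (⊤ : Submodule A A) ≠ ⊤ := fun h => by
    rw [smul_eq_mul, Ideal.mul_top] at h
    exact (IsLocalRing.maximalIdeal.isMaximal A).ne_top (top_le_iff.mp (h ▸ hle))
  have : Nontrivial (A ⧸ Ideal.ofList rs • (⊤ : Submodule A A)) :=
    Submodule.Quotient.nontrivial_iff.mpr hne
  have : Nontrivial (X ⧸ Ideal.ofList rs • (⊤ : Submodule A X)) := by
    by_contra h
    rw [not_nontrivial_iff_subsingleton] at h
    have := ε.toEquiv.subsingleton
    exact not_subsingleton (A ⧸ Ideal.ofList rs • (⊤ : Submodule A A)) this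
  have hQ : ∀ a ∈ Ideal.ofList rs, ∀ y : X ⧸ Ideal.ofList rs • (⊤ : Submodule A X), a • y = 0 := by
    intro a ha y
    obtain ⟨y, rfl⟩ := Submodule.mkQ_surjective _ y
    rw [← map_smul, Submodule.mkQ_apply, Submodule.Quotient.mk_eq_zero]
    exact Submodule.smul_mem_smul ha trivial
  have hend : ∀ φ : (X ⧸ Ideal.ofList rs • (⊤ : Submodule A X)) →ₗ[A]
      (X ⧸ Ideal.ofList rs • (⊤ : Submodule A X)), ∃ a : A, φ = a • LinearMap.id := by
    intro φ
    obtain ⟨z, rfl⟩ := ε.surjective φ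
    obtain ⟨a, rfl⟩ := Submodule.mkQ_surjective _ z
    exact ⟨a, hε a⟩
  obtain ⟨φ⟩ := nonempty_linearMap_equiv_end hprim hQ
    (exists_extension_quotient hmem hprim hrs (n₀ := n₀) hX) hend he hess
  exact ⟨φ.trans ε.symm⟩

theorem isLocalizedModule_id_of_bijective {R : Type u} [CommRing R] (S : Submonoid R) {E : Type u}
    [AddCommGroup E] [Module R E] (h : ∀ s ∈ S, Function.Bijective (fun x : E => s • x)) :
    IsLocalizedModule S (LinearMap.id : E →ₗ[R] E) where
  map_units s := (Module.End.isUnit_iff _).mpr (h s s.2)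
  surj y := ⟨(y, 1), by simp⟩
  exists_of_eq {x y} hxy := ⟨1, by rw [show x = y from hxy]⟩

theorem IsInjectiveHull.nonempty_equiv {R : Type u} [CommRing R] {N E E' : Type u} [AddCommGroup N]
    [Module R N] [AddCommGroup E] [Module R E] [AddCommGroup E'] [Module R E']
    (h : IsInjectiveHull R N E) (h' : IsInjectiveHull R N E') : Nonempty (E ≃ₗ[R] E') := by
  obtain ⟨hE, ι, hι, hess⟩ := h
  obtain ⟨hE', ι', hι', hess'⟩ := h'
  obtain ⟨f, hf⟩ := Module.Injective.out (Q := E') ι hι ι'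
  have hinj : Function.Injective f := by
    rw [← LinearMap.ker_eq_bot]
    by_contra hne
    obtain ⟨x, ⟨hx, n, rfl⟩, hx0⟩ := (Submodule.ne_bot_iff _).1 (hess _ hne)
    have h1 : ι' n = 0 := by rw [← hf]; exact hx
    rw [map_eq_zero_iff _ hι'] at h1
    exact hx0 (by rw [h1, map_zero])
  obtain ⟨g, hg⟩ := Module.Injective.out (Q := E) f hinj LinearMap.id
  have hker : LinearMap.ker g = ⊥ := by
    by_contra hne
    obtain ⟨x, ⟨hx, n, rfl⟩, hx0⟩ := (Submodule.ne_bot_iff _).1 (hess' _ hne)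
    have h1 : g (ι' n) = 0 := hx
    rw [← hf, hg, LinearMap.id_apply, map_eq_zero_iff _ hι] at h1
    exact hx0 (by rw [h1, map_zero])
  refine ⟨LinearEquiv.ofBijective f ⟨hinj, fun y => ⟨g y, ?_⟩⟩⟩
  apply LinearMap.ker_eq_bot.1 hker
  rw [hg, LinearMap.id_apply]

theorem IsInjectiveHull.exists_module_localization {R : Type u} [CommRing R] [IsNoetherianRing R]
    {p : Ideal R} [p.IsPrime] {E : Type u} [AddCommGroup E] [Module R E]
    (h : IsInjectiveHull R (R ⧸ p) E) (A : Type u) [CommRing A] [Algebra R A]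
    [IsLocalization.AtPrime A p] [IsLocalRing A] :
    ∃ (E' : Type u) (_ : AddCommGroup E') (_ : Module R E') (_ : Module A E')
      (_ : IsScalarTower R A E'), Nonempty (E ≃ₗ[R] E') ∧ Module.Injective R E' ∧
      Module.Injective A E' ∧ ∃ e : E', (∀ a : A, a • e = 0 ↔ a ∈ IsLocalRing.maximalIdeal A) ∧
        ∀ x : E', x ≠ 0 → ∃ a : A, a • x = e := by
  obtain ⟨E', _, _, _, _, f, hf⟩ := exists_isLocalizedModule p.primeCompl A E
  have := isLocalizedModule_id_of_bijective p.primeCompl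
    (fun s hs => h.smul_bijective (r := s) hs)
  let φ : E ≃ₗ[R] E' := IsLocalizedModule.linearEquiv p.primeCompl LinearMap.id f
  have hR : Module.Injective R E := h.1
  obtain ⟨e, he, hess⟩ := h.exists_generator
  refine ⟨E', _, _, _, ‹_›, ⟨φ⟩, .of_ringEquiv (RingEquiv.refl R) φ,
    Module.injective_of_isLocalizedModule p.primeCompl f,
    φ e, fun a => ?_, fun x hx => ?_⟩
  · obtain ⟨r, s, rfl⟩ := IsLocalization.exists_mk'_eq p.primeCompl a
    rw [IsLocalization.AtPrime.mk'_mem_maximal_iff A p r s, ← he, ← map_eq_zero_iff φ φ.injective,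
      map_smul, ← algebraMap_smul A r, ← IsLocalization.mk'_spec A r s, mul_comm, mul_smul]
    have hu : IsUnit (algebraMap R A s) := IsLocalization.map_units A s
    rw [hu.smul_eq_zero]
  · obtain ⟨y, rfl⟩ := φ.surjective x
    obtain ⟨a, b, hab, hb⟩ := hess y (by rintro rfl; exact hx (map_zero φ))
    obtain ⟨u, hu⟩ : IsUnit (algebraMap R A b) :=
      IsLocalization.map_units A (⟨b, hb⟩ : p.primeCompl)
    refine ⟨((u⁻¹ : Aˣ) : A) * algebraMap R A a, ?_⟩
    rw [mul_smul, algebraMap_smul, ← map_smul, hab, map_smul, ← algebraMap_smul A b, ← hu,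
      smul_smul, Units.inv_mul, one_smul]

section Assembly

variable {R : Type u} [CommRing R] (S : Submonoid R) (A : Type u) [CommRing A] [Algebra R A]
  [IsLocalization S A]

/-- The quotient by a sequence from `R`, computed over `R` or over an `R`-algebra `A`. -/
noncomputable def quotientOfListEquiv (rs : List R) (M : Type u) [AddCommGroup M] [Module R M]
    [Module A M] [IsScalarTower R A M] :
    (M ⧸ Ideal.ofList rs • (⊤ : Submodule R M)) ≃ₗ[R]
      M ⧸ Ideal.ofList (rs.map (algebraMap R A)) • (⊤ : Submodule A M) :=
  (Submodule.quotEquivOfEq _ _ (by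
    rw [← Ideal.map_ofList, Ideal.smul_restrictScalars, Submodule.restrictScalars_top])).trans
    (Submodule.Quotient.restrictScalarsEquiv R _)

variable {E : Type u} [AddCommGroup E] [Module R E] [Module A E] [IsScalarTower R A E]

include S in
theorem torConcentrated_zero_localization :
    TorConcentrated (R := R) 0 A E (A →ₗ[R] E) := by
  have : Module.Flat R A := IsLocalization.flat A S
  refine ⟨fun k hk => ?_, ?_⟩
  · obtain ⟨k, rfl⟩ := Nat.exists_eq_succ_of_ne_zero hk
    exact subsingleton_tor_of_flat E k
  · have := isLocalizedModule_id S E A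
    have : IsLocalizedModule S (TensorProduct.mk R A E 1) :=
      (isLocalizedModule_iff_isBaseChange S A _).2 (TensorProduct.isBaseChange R E A)
    exact ⟨(torZeroEquiv A E).trans
      ((IsLocalizedModule.linearEquiv S (TensorProduct.mk R A E 1) LinearMap.id).trans
        (((LinearMap.extendScalarsOfIsLocalizationEquiv (M := A) (N := E) S A).trans
          (LinearMap.ringLmapEquivSelf A A E)).restrictScalars R).symm)⟩

include S in
theorem nonempty_linearMap_quotient_equiv_torsionBySet (rs : List R) :
    Nonempty (((A ⧸ Ideal.ofList rs • (⊤ : Submodule R A)) →ₗ[R] E) ≃ₗ[R]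
      Submodule.torsionBySet R E ((⊥ ⊔ Ideal.ofList rs : Ideal R) : Set R)) := by
  rw [bot_sup_eq]
  let Q := A ⧸ Ideal.ofList rs • (⊤ : Submodule R A)
  let q : A →ₗ[R] Q := (Ideal.ofList rs • (⊤ : Submodule R A)).mkQ
  have hq {r : R} (hr : r ∈ Ideal.ofList rs) : r • q 1 = 0 := by
    rw [← map_smul, Submodule.mkQ_apply, Submodule.Quotient.mk_eq_zero]
    exact Submodule.smul_mem_smul hr trivial
  let F : (Q →ₗ[R] E) →ₗ[R] Submodule.torsionBySet R E (Ideal.ofList rs : Set R) :=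
    LinearMap.codRestrict _ (LinearMap.applyₗ (q 1)) fun φ => by
      rw [Submodule.mem_torsionBySet_iff]
      rintro ⟨r, hr⟩
      change r • φ (q 1) = 0
      rw [← map_smul, hq hr, map_zero]
  refine ⟨LinearEquiv.ofBijective F ⟨?_, ?_⟩⟩
  · rw [injective_iff_map_eq_zero]
    intro φ hφ
    have h1 : φ (q 1) = 0 := congrArg Subtype.val hφ
    refine Submodule.linearMap_qext _ ?_
    apply (LinearMap.extendScalarsOfIsLocalizationEquiv (M := A) (N := E) S A).injective
    exact LinearMap.ext_ring h1
  · rintro ⟨x, hx⟩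
    rw [Submodule.mem_torsionBySet_iff] at hx
    let g : A →ₗ[R] E := (LinearMap.toSpanSingleton A E x).restrictScalars R
    have hg : Ideal.ofList rs • (⊤ : Submodule R A) ≤ LinearMap.ker g := by
      rw [Submodule.smul_le]
      intro r hr a _
      change (r • a) • x = 0
      rw [smul_assoc, smul_comm]
      have : r • x = 0 := hx ⟨r, hr⟩
      rw [this, smul_zero]
    refine ⟨Submodule.liftQ _ g hg, Subtype.ext ?_⟩
    change Submodule.liftQ _ g hg (q 1) = x
    rw [Submodule.mkQ_apply, Submodule.liftQ_apply]
    exact one_smul A x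

include A in
theorem nonempty_linearMap_localization_equiv {D X : Type u} [AddCommGroup D] [Module R D]
    [AddCommGroup X] [Module R X] (fX : D →ₗ[R] X) [IsLocalizedModule S fX] :
    Nonempty ((X →ₗ[R] E) ≃ₗ[R] (D →ₗ[R] E)) := by
  have hu (s : S) : IsUnit (algebraMap R (Module.End R E) s) := by
    rw [← (Algebra.lsmul R (A := A) R E).commutes]
    exact (IsLocalization.map_units A s).map _
  exact ⟨LinearEquiv.ofBijective (LinearMap.lcomp R E fX)
    ⟨fun _ _ h => IsLocalizedModule.ext S fX hu h,
      fun g => ⟨IsLocalizedModule.lift S fX g hu, IsLocalizedModule.lift_comp S fX g hu⟩⟩⟩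

end Assembly

theorem torConcentrated_linearMap_of_isWeaklyRegular {R : Type u} [CommRing R] [IsNoetherianRing R]
    {D : Type u} [AddCommGroup D] [Module R D] (hD : IsDualizing R D) {p : Ideal R} [p.IsPrime]
    {E₀ : Type u} [AddCommGroup E₀] [Module R E₀] (hE₀ : IsInjectiveHull R (R ⧸ p) E₀)
    (A : Type u) [CommRing A] [Algebra R A] [IsLocalization.AtPrime A p] [IsLocalRing A]
    {rs : List R} (hmem : ∀ r ∈ rs, r ∈ p) (hreg : RingTheory.Sequence.IsWeaklyRegular A rs)
    {N : ℕ} (hN : IsLocalRing.maximalIdeal A ^ N ≤ Ideal.ofList (rs.map (algebraMap R A))) :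
    TorConcentrated (R := R) rs.length (D →ₗ[R] E₀) E₀ E₀ := by
  obtain ⟨⟨hfin, hbij, hext⟩, n, hn⟩ := hD
  have : IsNoetherianRing A := IsLocalization.isNoetherianRing p.primeCompl A inferInstance
  obtain ⟨E, _, _, _, _, ⟨φ⟩, hER, hEA, e, he, hess⟩ := hE₀.exists_module_localization A
  obtain ⟨X, _, _, _, _, fX, _⟩ := exists_isLocalizedModule p.primeCompl A D
  have hXfin : Module.Finite A X := Module.Finite.of_isLocalizedModule p.primeCompl fX
  have hXdim : HasInjectiveDimensionLE (ModuleCat.of A X) n :=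
    hasInjectiveDimensionLE_of_isLocalizedModule p.primeCompl n (ModuleCat.of R D) fX hn
  have hXext : ∀ i, 1 ≤ i →
      Subsingleton (Abelian.Ext (ModuleCat.of A X) (ModuleCat.of A X) i) := by
    intro i hi
    obtain ⟨i, rfl⟩ := Nat.exists_eq_succ_of_ne_zero (Nat.one_le_iff_ne_zero.mp hi)
    exact subsingleton_ext_of_isLocalizedModule p.primeCompl fX i fX
      (subsingleton_abelianExt_of_extM i (hext _ hi))
  have hmemA : ∀ x ∈ rs.map (algebraMap R A), x ∈ IsLocalRing.maximalIdeal A := by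
    intro x hx
    obtain ⟨r, hr, rfl⟩ := List.mem_map.mp hx
    exact (IsLocalization.AtPrime.to_map_mem_maximal_iff A p r).mpr (hmem r hr)
  obtain ⟨hXreg, ⟨ε⟩⟩ := nonempty_linearMap_quotient_equiv
    (bijective_smul_id_of_isLocalizedModule p.primeCompl fX hbij) hXext (n₀ := n) hmemA hN
    ((RingTheory.Sequence.isWeaklyRegular_map_algebraMap_iff A A rs).mpr hreg) he hess
  rw [RingTheory.Sequence.isWeaklyRegular_map_algebraMap_iff] at hXreg
  obtain ⟨ψ⟩ := nonempty_linearMap_localization_equiv p.primeCompl A (E := E) fX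
  obtain ⟨τ⟩ := nonempty_linearMap_quotient_equiv_torsionBySet p.primeCompl A (E := E) rs
  have hE : ∀ x ∈ rs, ∀ y : E, ∃ n : ℕ, x ^ n • y = 0 := by
    intro x hx y
    obtain ⟨y, rfl⟩ := φ.surjective y
    obtain ⟨m, hm⟩ := hE₀.exists_pow_smul_eq_zero (hmem x hx) y
    exact ⟨m, by rw [← map_smul, hm, map_zero]⟩
  have hX : ∀ x ∈ rs, ∀ f : X →ₗ[R] E, ∃ n : ℕ, x ^ n • f = 0 := by
    intro x hx f
    obtain ⟨m, hm⟩ := linearMap_exists_pow_smul_eq_zero (hE x hx) (ψ f)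
    exact ⟨m, by rw [← map_eq_zero_iff ψ ψ.injective, map_smul, hm]⟩
  let κ : ((X ⧸ Ideal.ofList rs • (⊤ : Submodule R X)) →ₗ[R] E) ≃ₗ[R]
      A ⧸ Ideal.ofList rs • (⊤ : Submodule R A) :=
    (LinearEquiv.congrLeft E R (quotientOfListEquiv A rs X)).trans
      ((((LinearMap.extendScalarsOfIsLocalizationEquiv p.primeCompl A).trans ε).restrictScalars
        R).trans (quotientOfListEquiv A rs A).symm)
  have h1 := (torConcentrated_zero_localization p.primeCompl A (E := E)).quotient_ofList rs hreg
  rw [zero_add] at h1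
  have h2 := TorConcentrated.of_quotient_ofList rs (I := ⊥)
    (by rintro a rfl y; exact zero_smul R y) hXreg hX hE (h1.congr κ τ)
  let σ : Submodule.torsionBySet R E ((⊥ : Ideal R) : Set R) ≃ₗ[R] E :=
    LinearEquiv.ofTop _ (eq_top_iff.mpr fun y _ => by
      rw [Submodule.mem_torsionBySet_iff]
      rintro ⟨a, rfl⟩
      exact zero_smul R y)
  have h3 := h2.congr ((LinearEquiv.congrRight φ).trans ψ.symm) (σ.trans φ.symm)
  exact ⟨fun k hk => have := h3.1 k hk
      (torCongrRight k (D →ₗ[R] E₀) φ).toEquiv.subsingleton,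
    h3.2.map fun f => (torCongrRight _ (D →ₗ[R] E₀) φ).trans f⟩

end Pointwise

/-- Over a Cohen-Macaulay noetherian ring with dualizing module `D`, for primes
`p, q`: `Tor_k^R(Hom_R(D, E_R(R/p)), E_R(R/q))` vanishes if `p ≠ q` or `k ≠ ht p`, and is
isomorphic to `E_R(R/p)` if `p = q` and `k = ht p`. -/
theorem statement8 (R : Type u) [CommRing R] [IsNoetherianRing R]
    (hCM : IsCohenMacaulayRing R)
    (D : Type u) [AddCommGroup D] [Module R D] (hD : IsDualizing R D)
    (p q : Ideal R) (hp : p.IsPrime) (hq : q.IsPrime)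
    (Ep : Type u) [AddCommGroup Ep] [Module R Ep] (hEp : IsInjectiveHull R (R ⧸ p) Ep)
    (Eq : Type u) [AddCommGroup Eq] [Module R Eq] (hEq : IsInjectiveHull R (R ⧸ q) Eq)
    (k : ℕ) :
    (p ≠ q ∨ (k : ℕ∞) ≠ Order.height (⟨p, hp⟩ : PrimeSpectrum R) →
      Subsingleton (TorM R k (D →ₗ[R] Ep) Eq)) ∧
    (p = q → (k : ℕ∞) = Order.height (⟨p, hp⟩ : PrimeSpectrum R) →
      Nonempty ((TorM R k (D →ₗ[R] Ep) Eq) ≃ₗ[R] Ep)) := by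
  obtain ⟨rs, hmem, hlen, hreg, N, hN⟩ := hCM.exists_list p hp
  by_cases hpq : p = q
  · subst hpq
    obtain ⟨φ⟩ := hEq.nonempty_equiv hEp
    have h := torConcentrated_linearMap_of_isWeaklyRegular hD hEp (Localization.AtPrime p) hmem
      hreg hN
    rw [← hlen]
    refine ⟨fun hk => ?_, fun _ hk => ?_⟩
    · have hk' : k ≠ rs.length := fun hk' =>
        (hk.resolve_left (not_not_intro rfl)) (congrArg Nat.cast hk')
      have := h.1 k hk'
      exact (torCongrRight k (D →ₗ[R] Ep) φ).toEquiv.subsingleton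
    · obtain rfl : k = rs.length := by exact_mod_cast hk
      exact h.2.map fun f => (torCongrRight _ (D →ₗ[R] Ep) φ).trans f
  · have := hD.1.1
    exact ⟨fun _ => subsingleton_tor_linearMap_of_ne hpq D hEp hEq k, fun h => absurd h hpq⟩
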